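/- arXiv:1410.6182 — 6 statements merged into one kernel-verified Lean document; each statement's English description precedes it below -/
import Mathlib

section
/- Pointwise bound on the Boltzmann collision frequency for soft potentials (Lemma 3.1, case 2). Let d ≥ 2 be an integer, γ ∈ (−d,0), C_Φ > 0, and let Φ : (0,∞) → [0,∞) be measurable with Φ(z) ≤ C_Φ z^γ for all z > 0. Let p ≥ 1 with p > d/(d+γ). Then there exists a constant cst > 0, depending only on d, γ and p, such that for every measurable g : ℝ^d → [0,∞) and every v ∈ ℝ^d one has ∫_{ℝ^d} Φ(|v−v_*|) g(v_*) dv_* ≤ cst · C_Φ · (e_g + ‖g‖_{L^p(ℝ^d)}), where e_g = ∫_{ℝ^d} (1+|v_*|²) g(v_*) dv_*. In particular, for any angular kernel b ≥ 0 with n_b < ∞, |L[g](v)| ≤ cst · n_b · C_Φ · (e_g + ‖g‖_{L^p}). -/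
open MeasureTheory Real
open scoped RealInnerProductSpace ENNReal

noncomputable section

/-- Velocity space `ℝ^d`. -/
abbrev Vd (d : ℕ) := EuclideanSpace ℝ (Fin d)

/-- Surface measure on the unit sphere `S^{d-1} ⊂ ℝ^d`. -/
def sphMeas (d : ℕ) : Measure (Metric.sphere (0 : Vd d) 1) :=
  (volume : Measure (Vd d)).toSphere

/-- The power `‖x‖ ^ s` is integrable near the origin when `s > -dim E`. -/
lemma integrableOn_ball_norm_rpow {E : Type*} [NormedAddCommGroup E] [NormedSpace ℝ E]
    [FiniteDimensional ℝ E] [Nontrivial E] [MeasurableSpace E] [BorelSpace E]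
    (μ : Measure E) [μ.IsAddHaarMeasure] {s : ℝ} (hs : -(Module.finrank ℝ E : ℝ) < s) :
    IntegrableOn (fun x : E => ‖x‖ ^ s) (Metric.ball 0 1) μ := by
  rw [integrableOn_fun_norm_addHaar μ (f := fun y : ℝ => y ^ s)]
  have hdim : 1 ≤ Module.finrank ℝ E := Module.finrank_pos
  have h : IntegrableOn (fun y : ℝ => y ^ ((Module.finrank ℝ E - 1 : ℕ) + s)) (Set.Ioo 0 1) := by
    rw [intervalIntegral.integrableOn_Ioo_rpow_iff one_pos]
    push_cast [hdim]
    linarith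
  refine h.congr_fun (fun y hy => ?_) measurableSet_Ioo
  simp only [smul_eq_mul]
  rw [rpow_add hy.1, rpow_natCast]

/-- The Riesz-type singularity `‖x‖ ^ s` truncated to the unit ball. -/
def truncRiesz {E : Type*} [NormedAddCommGroup E] (s : ℝ) : E → ℝ≥0∞ :=
  (Metric.ball 0 1).indicator fun x => ENNReal.ofReal (‖x‖ ^ s)

lemma measurable_truncRiesz {E : Type*} [NormedAddCommGroup E] [MeasurableSpace E]
    [OpensMeasurableSpace E] (s : ℝ) : Measurable (truncRiesz s : E → ℝ≥0∞) :=
  Measurable.indicator (by fun_prop) measurableSet_ball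

lemma lintegral_truncRiesz_rpow_lt_top {E : Type*} [NormedAddCommGroup E] [NormedSpace ℝ E]
    [FiniteDimensional ℝ E] [Nontrivial E] [MeasurableSpace E] [BorelSpace E]
    (μ : Measure E) [μ.IsAddHaarMeasure] {s q : ℝ} (hq : 0 < q)
    (hs : -(Module.finrank ℝ E : ℝ) < s * q) :
    ∫⁻ x : E, truncRiesz s x ^ q ∂μ < ⊤ := by
  have heq : ∀ x : E, truncRiesz s x ^ q =
      (Metric.ball (0 : E) 1).indicator (fun x => ENNReal.ofReal (‖x‖ ^ (s * q))) x := by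
    intro x
    by_cases hx : x ∈ Metric.ball (0 : E) 1
    · rw [truncRiesz, Set.indicator_of_mem hx, Set.indicator_of_mem hx,
        ENNReal.ofReal_rpow_of_nonneg (by positivity) hq.le, ← rpow_mul (norm_nonneg x)]
    · rw [truncRiesz, Set.indicator_of_notMem hx, Set.indicator_of_notMem hx,
        ENNReal.zero_rpow_of_pos hq]
  simp_rw [heq]
  rw [lintegral_indicator measurableSet_ball]
  exact (integrableOn_ball_norm_rpow μ hs).lintegral_lt_top

/-- A nonpositive power of the norm is at most one plus its truncation. -/
lemma ofReal_norm_rpow_le_one_add_truncRiesz {E : Type*} [NormedAddCommGroup E] {s : ℝ}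
    (hs : s ≤ 0) (x : E) : ENNReal.ofReal (‖x‖ ^ s) ≤ 1 + truncRiesz s x := by
  by_cases hx : x ∈ Metric.ball (0 : E) 1
  · rw [truncRiesz, Set.indicator_of_mem hx]
    exact le_add_self
  · refine le_add_right (ENNReal.ofReal_le_one.2 (rpow_le_one_of_one_le_of_nonpos ?_ hs))
    simpa using hx

/-- Pointwise bound on the Boltzmann collision frequency for soft potentials
(Lemma 3.1, case 2), together with the resulting bound on the loss operator
`L[g](v) = n_b ∫ Φ(|v-v_*|) g(v_*) dv_*`. -/
theorem collision_frequency_bound_soft_potentials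
    (d : ℕ) (hd : 2 ≤ d) (γ : ℝ) (hγ₁ : -(d : ℝ) < γ) (hγ₂ : γ < 0)
    (p : ℝ) (hp1 : 1 ≤ p) (hp : (d : ℝ) / ((d : ℝ) + γ) < p) :
    ∃ cst : ℝ, 0 < cst ∧
      ∀ CΦ : ℝ, 0 < CΦ →
      ∀ Φ : ℝ → ℝ, Measurable Φ → (∀ z : ℝ, 0 ≤ Φ z) →
        (∀ z : ℝ, 0 < z → Φ z ≤ CΦ * z ^ γ) →
      ∀ g : Vd d → ℝ, Measurable g → (∀ w : Vd d, 0 ≤ g w) →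
      ∀ v : Vd d,
        (∫⁻ vs : Vd d, ENNReal.ofReal (Φ ‖v - vs‖ * g vs)) ≤
            ENNReal.ofReal (cst * CΦ) *
              ((∫⁻ vs : Vd d, ENNReal.ofReal ((1 + ‖vs‖ ^ 2) * g vs)) +
                eLpNorm g (ENNReal.ofReal p) volume)
        ∧ ∀ b : ℝ → ℝ, (∀ s : ℝ, 0 ≤ b s) →
          ∀ nb : ℝ≥0∞, nb ≠ ⊤ →
            (∀ u : Vd d, ‖u‖ = 1 →
              (∫⁻ σ : Metric.sphere (0 : Vd d) 1,
                ENNReal.ofReal (b ⟪(σ : Vd d), u⟫) ∂(sphMeas d)) = nb) →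
            nb * (∫⁻ vs : Vd d, ENNReal.ofReal (Φ ‖v - vs‖ * g vs)) ≤
              nb * ENNReal.ofReal (cst * CΦ) *
                ((∫⁻ vs : Vd d, ENNReal.ofReal ((1 + ‖vs‖ ^ 2) * g vs)) +
                  eLpNorm g (ENNReal.ofReal p) volume) := by
  have hdγ : 0 < (d : ℝ) + γ := by linarith
  have hdp : (d : ℝ) < p * (d + γ) := (div_lt_iff₀ hdγ).1 hp
  have hp1' : 1 < p := lt_of_le_of_ne hp1 (by rintro rfl; linarith)
  have hpq := HolderConjugate.conjExponent hp1'
  set q := p.conjExponent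
  have : Nonempty (Fin d) := ⟨⟨0, by omega⟩⟩
  have hγq : -(Module.finrank ℝ (Vd d) : ℝ) < γ * q := by
    have hp1'' : 0 < p - 1 := by linarith
    rw [finrank_euclideanSpace_fin, hpq.conjugate_eq, ← mul_div_assoc, lt_div_iff₀ hp1'']
    linarith
  set K : ℝ≥0∞ := (∫⁻ x : Vd d, truncRiesz γ x ^ q) ^ (1 / q) with hK
  have hKtop : K ≠ ⊤ := ENNReal.rpow_ne_top_of_nonneg (one_div_nonneg.2 hpq.symm.nonneg)
    (lintegral_truncRiesz_rpow_lt_top volume hpq.symm.pos hγq).ne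
  refine ⟨1 + K.toReal, by positivity, fun CΦ hCΦ Φ _ _ hΦ g hg hg0 v => ?_⟩
  set N := eLpNorm g (ENNReal.ofReal p) volume
  set e := ∫⁻ vs : Vd d, ENNReal.ofReal ((1 + ‖vs‖ ^ 2) * g vs)
  have hholder : ∫⁻ w : Vd d, truncRiesz γ (v - w) * ENNReal.ofReal (g w) ≤ K * N := by
    have hkm : Measurable fun w : Vd d => truncRiesz γ (v - w) :=
      (measurable_truncRiesz γ).comp (by fun_prop)
    refine (ENNReal.lintegral_mul_le_Lp_mul_Lq volume hpq.symm hkm.aemeasurable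
      hg.ennreal_ofReal.aemeasurable).trans_eq ?_
    have hN : eLpNorm g (ENNReal.ofReal p) volume = (∫⁻ w, ENNReal.ofReal (g w) ^ p) ^ (1 / p) := by
      have hp0 : ENNReal.ofReal p ≠ 0 := by simpa using hpq.pos
      simp_rw [← Real.enorm_of_nonneg (hg0 _)]
      rw [eLpNorm_eq_lintegral_rpow_enorm_toReal hp0 ENNReal.ofReal_ne_top,
        ENNReal.toReal_ofReal hpq.nonneg]
    rw [← hN, hK, lintegral_sub_left_eq_self (fun x : Vd d => truncRiesz γ x ^ q) v]
  have hpt : ∀ᵐ w : Vd d, ENNReal.ofReal (Φ ‖v - w‖ * g w) ≤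
      ENNReal.ofReal CΦ * (ENNReal.ofReal ((1 + ‖w‖ ^ 2) * g w) +
        truncRiesz γ (v - w) * ENNReal.ofReal (g w)) := by
    filter_upwards [Measure.ae_ne volume v] with w hw
    calc ENNReal.ofReal (Φ ‖v - w‖ * g w)
        ≤ ENNReal.ofReal (CΦ * (‖v - w‖ ^ γ * g w)) := by
          rw [← mul_assoc]
          exact ENNReal.ofReal_le_ofReal (mul_le_mul_of_nonneg_right
            (hΦ _ (norm_pos_iff.2 (sub_ne_zero.2 hw.symm))) (hg0 w))
      _ = ENNReal.ofReal CΦ * (ENNReal.ofReal (‖v - w‖ ^ γ) * ENNReal.ofReal (g w)) := by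
          rw [ENNReal.ofReal_mul hCΦ.le, ENNReal.ofReal_mul (by positivity)]
      _ ≤ ENNReal.ofReal CΦ * ((1 + truncRiesz γ (v - w)) * ENNReal.ofReal (g w)) := by
          gcongr
          exact ofReal_norm_rpow_le_one_add_truncRiesz hγ₂.le _
      _ ≤ _ := by
          rw [add_mul, one_mul]
          gcongr
          exact le_mul_of_one_le_left (hg0 w) (by nlinarith [sq_nonneg ‖w‖])
  have hmain : ∫⁻ w : Vd d, ENNReal.ofReal (Φ ‖v - w‖ * g w) ≤
      ENNReal.ofReal ((1 + K.toReal) * CΦ) * (e + N) := by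
    calc ∫⁻ w : Vd d, ENNReal.ofReal (Φ ‖v - w‖ * g w)
        ≤ ∫⁻ w : Vd d, ENNReal.ofReal CΦ * (ENNReal.ofReal ((1 + ‖w‖ ^ 2) * g w) +
            truncRiesz γ (v - w) * ENNReal.ofReal (g w)) := lintegral_mono_ae hpt
      _ = ENNReal.ofReal CΦ * (e +
            ∫⁻ w : Vd d, truncRiesz γ (v - w) * ENNReal.ofReal (g w)) := by
          rw [lintegral_const_mul' _ _ ENNReal.ofReal_ne_top, lintegral_add_left (by fun_prop)]
      _ ≤ ENNReal.ofReal CΦ * ((1 + K) * (e + N)) := by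
          gcongr
          calc _ ≤ e + K * N := by gcongr
            _ ≤ (1 + K) * e + (1 + K) * N := by
              gcongr
              · exact le_mul_of_one_le_left' le_self_add
              · exact le_add_self
            _ = _ := (mul_add _ _ _).symm
      _ = _ := by
          rw [mul_comm (1 + K.toReal), ENNReal.ofReal_mul hCΦ.le,
            ENNReal.ofReal_add zero_le_one ENNReal.toReal_nonneg, ENNReal.ofReal_one,
            ENNReal.ofReal_toReal hKtop, mul_assoc]
  refine ⟨hmain, fun b _ nb _ _ => ?_⟩
  rw [mul_assoc]
  gcongr

end
end

section
/- L∞ bound on the linear operator S via the (1 − cos θ)-moment of the angular kernel (Lemma 4.1, hard-potential case). Let d ≥ 2 be an integer and γ ∈ [0,1]. Let b : [−1,1] → [0,∞) be measurable with b(s) = 0 for s < 0 (i.e. b(cos θ) vanishes for θ > π/2) and n_b < ∞. Let g : ℝ^d → [0,∞) be measurable with e_g := ∫_{ℝ^d} (1+|v_*|²) g(v_*) dv_* < ∞, and define S[g](v) = ∫_{ℝ^d} ∫_{S^{d−1}} |v−v_*|^γ b(cos θ) ( g(v_*) − g(v'_*) ) dσ dv_*. Then this integral converges absolutely for every v ∈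 ℝ^d, and there exists a constant cst > 0, depending only on d and γ, such that |S[g](v)| ≤ cst · m_b · e_g · ⟨v⟩^γ for all v ∈ ℝ^d. -/
open MeasureTheory Real
open scoped RealInnerProductSpace ENNReal

noncomputable section

/-- Post-collisional velocity `v' = (v+v_*)/2 + (|v-v_*|/2)σ`. -/
def vPost (d : ℕ) (v vs : Vd d) (σ : Metric.sphere (0 : Vd d) 1) : Vd d :=
  (2 : ℝ)⁻¹ • (v + vs) + (‖v - vs‖ / 2) • (σ : Vd d)

/-- Post-collisional velocity `v'_* = (v+v_*)/2 - (|v-v_*|/2)σ`. -/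
def vPostStar (d : ℕ) (v vs : Vd d) (σ : Metric.sphere (0 : Vd d) 1) : Vd d :=
  (2 : ℝ)⁻¹ • (v + vs) - (‖v - vs‖ / 2) • (σ : Vd d)

/-- `cos θ = σ · (v-v_*)/|v-v_*|`. -/
def cosTheta (d : ℕ) (v vs : Vd d) (σ : Metric.sphere (0 : Vd d) 1) : ℝ :=
  ⟪‖v - vs‖⁻¹ • (v - vs), (σ : Vd d)⟫

open scoped Pointwise

section InvariantMeasures

variable {E : Type*} [NormedAddCommGroup E] [InnerProductSpace ℝ E]

lemma exists_linearIsometryEquiv_apply_eq {x y : E} (h : ‖x‖ = ‖y‖) :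
    ∃ L : E ≃ₗᵢ[ℝ] E, L x = y :=
  ⟨_, Submodule.reflection_sub h⟩

variable [MeasurableSpace E] [BorelSpace E]

lemma charFun_eq_of_norm_eq {ν : Measure E} (hν : ∀ L : E ≃ₗᵢ[ℝ] E, ν.map L = ν) {s t : E}
    (h : ‖s‖ = ‖t‖) : charFun ν s = charFun ν t := by
  obtain ⟨L, rfl⟩ := exists_linearIsometryEquiv_apply_eq h
  conv_rhs => rw [← hν L]
  rw [charFun_apply, charFun_apply, integral_map L.continuous.measurable.aemeasurable]
  · simp
  · exact (by fun_prop : Continuous _).aestronglyMeasurable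

/-- Two finite measures on the unit sphere that are invariant under linear isometries are
proportional. -/
theorem measure_univ_smul_eq_of_isometry_invariant [FiniteDimensional ℝ E] {μ ν : Measure E}
    [IsFiniteMeasure μ] [IsFiniteMeasure ν]
    (hμ : ∀ L : E ≃ₗᵢ[ℝ] E, μ.map L = μ) (hν : ∀ L : E ≃ₗᵢ[ℝ] E, ν.map L = ν)
    (hμ1 : ∀ᵐ x ∂μ, ‖x‖ = 1) (hν1 : ∀ᵐ x ∂ν, ‖x‖ = 1) :
    μ Set.univ • ν = ν Set.univ • μ := by
  have : IsFiniteMeasure (μ Set.univ • ν) := ν.smul_finite (measure_ne_top μ _)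
  have : IsFiniteMeasure (ν Set.univ • μ) := μ.smul_finite (measure_ne_top ν _)
  refine Measure.ext_of_charFun (funext fun t => ?_)
  have key : ∀ (ρ τ : Measure E) [IsFiniteMeasure ρ] [IsFiniteMeasure τ],
      (∀ L : E ≃ₗᵢ[ℝ] E, τ.map L = τ) → (∀ᵐ x ∂ρ, ‖x‖ = 1) →
      charFun (ρ Set.univ • τ) t =
        ∫ x, ∫ y, Complex.exp (⟪y, ‖t‖ • x⟫ * Complex.I) ∂τ ∂ρ := by
    intro ρ τ _ _ hτ hρ
    have h1 : ∀ᵐ x ∂ρ, ∫ y, Complex.exp (⟪y, ‖t‖ • x⟫ * Complex.I) ∂τ = charFun τ t := by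
      filter_upwards [hρ] with x hx
      rw [← charFun_apply]
      exact charFun_eq_of_norm_eq hτ (by simp [norm_smul, hx])
    rw [integral_congr_ae h1, charFun_apply, integral_smul_measure, ← charFun_apply]
    simp [Measure.real]
  rw [key μ ν hν hμ1, key ν μ hμ hν1, integral_integral_swap]
  · simp_rw [inner_smul_right, real_inner_comm]
  · refine Integrable.of_bound (C := 1)
      (by fun_prop : Continuous _).aestronglyMeasurable (.of_forall fun p => ?_)
    simp [Function.uncurry, Complex.norm_exp]

end InvariantMeasures

section SurfaceMeasure

variable (E : Type*) [NormedAddCommGroup E] [InnerProductSpace ℝ E] [FiniteDimensional ℝ E]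
  [MeasurableSpace E] [BorelSpace E]

/-- Surface measure on the unit sphere, as a measure on the ambient space. -/
def surfaceMeasure : Measure E :=
  (volume : Measure E).toSphere.map (↑)

instance : IsFiniteMeasure (surfaceMeasure E) := by
  unfold surfaceMeasure; infer_instance

variable {E}

lemma surfaceMeasure_apply {s : Set E} (hs : MeasurableSet s) :
    surfaceMeasure E s =
      Module.finrank ℝ E * volume (Set.Ioo (0 : ℝ) 1 • (s ∩ Metric.sphere 0 1)) := by
  rw [surfaceMeasure, Measure.map_apply measurable_subtype_coe hs,
    Measure.toSphere_apply' _ (measurable_subtype_coe hs), Subtype.image_preimage_coe,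
    Set.inter_comm]

lemma surfaceMeasure_map (L : E ≃ₗᵢ[ℝ] E) : (surfaceMeasure E).map L = surfaceMeasure E := by
  ext s hs
  rw [Measure.map_apply L.continuous.measurable hs, surfaceMeasure_apply hs,
    surfaceMeasure_apply (L.continuous.measurable hs)]
  congr 1
  rw [← (L.measurePreserving).measure_preimage_equiv (f := L.toMeasurableEquiv)
    (Set.Ioo (0 : ℝ) 1 • (s ∩ Metric.sphere 0 1))]
  congr 1
  ext x
  simp only [Set.mem_smul, Set.mem_inter_iff, Set.mem_preimage, mem_sphere_zero_iff_norm]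
  constructor
  · rintro ⟨r, hr, y, ⟨hy, hy1⟩, rfl⟩
    exact ⟨r, hr, L y, ⟨hy, by simpa using hy1⟩, (L.map_smul r y).symm⟩
  · rintro ⟨r, hr, y, ⟨hy, hy1⟩, h⟩
    refine ⟨r, hr, L.symm y, ⟨by simpa using hy, by simpa using hy1⟩, ?_⟩
    rw [← map_smul, h]
    exact L.symm_apply_apply x

lemma ae_surfaceMeasure_norm_eq_one : ∀ᵐ x ∂surfaceMeasure E, ‖x‖ = 1 := by
  rw [surfaceMeasure, ae_map_iff measurable_subtype_coe.aemeasurable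
    (measurableSet_eq_fun (by fun_prop) (by fun_prop))]
  exact .of_forall fun x => by simp

lemma surfaceMeasure_univ_ne_zero [Nontrivial E] : surfaceMeasure E Set.univ ≠ 0 := by
  rw [surfaceMeasure, Measure.map_apply measurable_subtype_coe .univ]
  exact Measure.measure_univ_ne_zero.2 (Measure.toSphere_ne_zero (volume : Measure E))

lemma lintegral_surfaceMeasure (f : E → ℝ≥0∞) (hf : Measurable f) :
    ∫⁻ x, f x ∂surfaceMeasure E =
      ∫⁻ x : Metric.sphere (0 : E) 1, f x ∂(volume : Measure E).toSphere := by
  rw [surfaceMeasure, lintegral_map hf measurable_subtype_coe]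

lemma lintegral_surfaceMeasure_comp (f : E → ℝ≥0∞) (hf : Measurable f) (L : E ≃ₗᵢ[ℝ] E) :
    ∫⁻ x, f (L x) ∂surfaceMeasure E = ∫⁻ x, f x ∂surfaceMeasure E := by
  conv_rhs => rw [← surfaceMeasure_map L, lintegral_map hf L.continuous.measurable]

/-- Integration in polar coordinates. -/
lemma lintegral_eq_lintegral_surfaceMeasure [Nontrivial E] (f : E → ℝ≥0∞) (hf : Measurable f) :
    ∫⁻ x, f x = ∫⁻ ω, (∫⁻ r in Set.Ioi (0 : ℝ),
      ENNReal.ofReal (r ^ (Module.finrank ℝ E - 1)) * f (r • ω)) ∂surfaceMeasure E := by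
  have h0 : MeasurableSet ({0}ᶜ : Set E) := (measurableSet_singleton 0).compl
  have hm : Measurable fun p : Metric.sphere (0 : E) 1 × Set.Ioi (0 : ℝ) =>
      f (p.2.1 • p.1.1) := by fun_prop
  calc ∫⁻ x, f x = ∫⁻ x in {0}ᶜ, f x := by rw [restrict_compl_singleton]
    _ = ∫⁻ x : ({0}ᶜ : Set E), f x.1 ∂(volume.comap Subtype.val) :=
      (lintegral_subtype_comap h0 f).symm
    _ = ∫⁻ p : Metric.sphere (0 : E) 1 × Set.Ioi (0 : ℝ), f (p.2.1 • p.1.1)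
          ∂((volume : Measure E).toSphere.prod
            (.volumeIoiPow (Module.finrank ℝ E - 1))) := by
      rw [← (volume.measurePreserving_homeomorphUnitSphereProd (E := E)).lintegral_comp hm]
      refine lintegral_congr fun x => ?_
      congr 1
      have hx : ‖(x : E)‖ ≠ 0 := norm_ne_zero_iff.2 x.2
      simp [smul_smul, hx]
    _ = _ := by
      rw [lintegral_prod _ hm.aemeasurable, lintegral_surfaceMeasure]
      · refine lintegral_congr fun ω => ?_
        have hmr : Measurable fun r : Set.Ioi (0 : ℝ) => f ((r : ℝ) • (ω : E)) := by fun_prop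
        rw [Measure.volumeIoiPow, lintegral_withDensity_eq_lintegral_mul _ (by fun_prop) hmr]
        exact lintegral_subtype_comap measurableSet_Ioi
          (fun r : ℝ => ENNReal.ofReal (r ^ (Module.finrank ℝ E - 1)) * f (r • (ω : E)))
      · exact Measurable.lintegral_prod_right (by fun_prop)

lemma lintegral_inner_surfaceMeasure_eq (K : ℝ → ℝ≥0∞) (hK : Measurable K) {u w : E}
    (h : ‖u‖ = ‖w‖) :
    ∫⁻ x, K ⟪x, u⟫ ∂surfaceMeasure E = ∫⁻ x, K ⟪x, w⟫ ∂surfaceMeasure E := by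
  obtain ⟨L, rfl⟩ := exists_linearIsometryEquiv_apply_eq h
  rw [← lintegral_surfaceMeasure_comp (fun x => K ⟪x, L u⟫) (by fun_prop) L]
  simp

/-- Averaging a function of the bisecting direction against a kernel depending only on the
angle. -/
lemma lintegral_bisector [Nontrivial E] (K : ℝ → ℝ≥0∞) (hK : Measurable K) (hK1 : K (-1) = 0)
    {u : E} (hu : ‖u‖ = 1) (hfin : ∫⁻ x, K ⟪x, u⟫ ∂surfaceMeasure E ≠ ∞)
    (F : E → ℝ≥0∞) (hF : Measurable F) :
    ∫⁻ ω, ∫⁻ σ, K ⟪σ, ω⟫ * F (‖ω + σ‖⁻¹ • (ω + σ)) ∂surfaceMeasure E ∂surfaceMeasure E =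
      (∫⁻ x, K ⟪x, u⟫ ∂surfaceMeasure E) * ∫⁻ x, F x ∂surfaceMeasure E := by
  set μ := surfaceMeasure E with hμ
  set κ := ∫⁻ x, K ⟪x, u⟫ ∂μ with hκ
  set n : E × E → E := fun p => ‖p.1 + p.2‖⁻¹ • (p.1 + p.2) with hn
  have hnm : Measurable n := by fun_prop
  have hKm : Measurable fun p : E × E => K ⟪p.2, p.1⟫ := by fun_prop
  set ν : Measure E := ((μ.prod μ).withDensity fun p => K ⟪p.2, p.1⟫).map n with hν
  have hνl : ∀ G : E → ℝ≥0∞, Measurable G →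
      ∫⁻ x, G x ∂ν = ∫⁻ ω, ∫⁻ σ, K ⟪σ, ω⟫ * G (‖ω + σ‖⁻¹ • (ω + σ)) ∂μ ∂μ := by
    intro G hG
    have hGn : Measurable fun p => G (n p) := hG.comp hnm
    rw [hν, lintegral_map hG hnm, lintegral_withDensity_eq_lintegral_mul _ hKm hGn,
      lintegral_prod _ (by fun_prop)]
    rfl
  have hνuniv : ν Set.univ = κ * μ Set.univ := by
    rw [← lintegral_one, hνl _ measurable_const]
    have : ∀ᵐ ω ∂μ, ∫⁻ σ, K ⟪σ, ω⟫ * 1 ∂μ = κ := by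
      filter_upwards [ae_surfaceMeasure_norm_eq_one] with ω hω
      simp only [mul_one]
      exact lintegral_inner_surfaceMeasure_eq K hK (hω.trans hu.symm)
    rw [lintegral_congr_ae this, lintegral_const]
  have : IsFiniteMeasure ν := ⟨by
    rw [hνuniv]
    exact ENNReal.mul_lt_top hfin.lt_top (measure_lt_top _ _)⟩
  have hνinv : ∀ L : E ≃ₗᵢ[ℝ] E, ν.map L = ν := by
    intro L
    refine Measure.ext_of_lintegral _ fun G hG => ?_
    have hGL : Measurable fun x => G (L x) := hG.comp L.continuous.measurable
    rw [lintegral_map hG L.continuous.measurable, hνl _ hG, hνl _ hGL]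
    rw [← lintegral_surfaceMeasure_comp
      (fun ω => ∫⁻ σ, K ⟪σ, ω⟫ * G (‖ω + σ‖⁻¹ • (ω + σ)) ∂μ)
      (Measurable.lintegral_prod_right (by fun_prop)) L]
    refine lintegral_congr fun ω => ?_
    rw [← lintegral_surfaceMeasure_comp
      (fun σ => K ⟪σ, L ω⟫ * G (‖L ω + σ‖⁻¹ • (L ω + σ))) (by fun_prop) L]
    refine lintegral_congr fun σ => ?_
    rw [L.inner_map_map, ← map_add, L.norm_map, map_smul]
  have hν1 : ∀ᵐ x ∂ν, ‖x‖ = 1 := by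
    have hm : MeasurableSet {x : E | ‖x‖ = 1} :=
      measurableSet_eq_fun (by fun_prop) (by fun_prop)
    rw [hν, ae_map_iff hnm.aemeasurable hm, ae_withDensity_iff hKm]
    have h1 : ∀ᵐ p ∂μ.prod μ, ‖p.1‖ = 1 :=
      Measure.quasiMeasurePreserving_fst.ae ae_surfaceMeasure_norm_eq_one
    filter_upwards [h1] with p hp1 hp
    have hne : p.1 + p.2 ≠ 0 := by
      intro h0
      apply hp
      rw [eq_neg_of_add_eq_zero_right h0, inner_neg_left, real_inner_self_eq_norm_sq, hp1]
      simpa using hK1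
    simp only [hn, norm_smul, norm_inv, norm_norm]
    exact inv_mul_cancel₀ (norm_ne_zero_iff.2 hne)
  have hprop := measure_univ_smul_eq_of_isometry_invariant (μ := μ) (ν := ν)
    surfaceMeasure_map hνinv ae_surfaceMeasure_norm_eq_one hν1
  have h2 : μ Set.univ * ∫⁻ x, F x ∂ν = κ * μ Set.univ * ∫⁻ x, F x ∂μ := by
    rw [← hνuniv]
    simpa using congrArg (fun ρ : Measure E => ∫⁻ x, F x ∂ρ) hprop
  rw [← hνl F hF]
  have h3 : μ Set.univ * ∫⁻ x, F x ∂ν = μ Set.univ * (κ * ∫⁻ x, F x ∂μ) := by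
    rw [h2]; ring
  exact (ENNReal.mul_right_inj surfaceMeasure_univ_ne_zero (measure_ne_top _ _)).1 h3

lemma lintegral_Ioi_rpow_mul_comp_mul_right (p : ℝ) {c : ℝ} (hc : 0 < c) (φ : ℝ → ℝ≥0∞)
    (hφ : Measurable φ) :
    ∫⁻ r in Set.Ioi (0 : ℝ), ENNReal.ofReal (r ^ p) * φ (r * c) =
      ENNReal.ofReal (c ^ (-(p + 1))) *
        ∫⁻ r in Set.Ioi (0 : ℝ), ENNReal.ofReal (r ^ p) * φ r := by
  set ψ : ℝ → ℝ≥0∞ := (Set.Ioi (0 : ℝ)).indicator fun r => ENNReal.ofReal (r ^ p) * φ r with hψ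
  have hψm : Measurable ψ := Measurable.indicator (by fun_prop) measurableSet_Ioi
  have h1 : ∀ r : ℝ, (Set.Ioi (0 : ℝ)).indicator
      (fun r => ENNReal.ofReal (r ^ p) * φ (r * c)) r = ENNReal.ofReal (c ^ (-p)) * ψ (r * c) := by
    intro r
    by_cases hr : 0 < r
    · rw [hψ, Set.indicator_of_mem (Set.mem_Ioi.2 hr),
        Set.indicator_of_mem (Set.mem_Ioi.2 (mul_pos hr hc)), ← mul_assoc,
        ← ENNReal.ofReal_mul (by positivity), mul_rpow hr.le hc.le, mul_left_comm,
        ← rpow_add hc, neg_add_cancel, rpow_zero, mul_one]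
    · have hrc : ¬ 0 < r * c := fun h => hr (pos_of_mul_pos_left h hc.le)
      rw [hψ, Set.indicator_of_notMem (by simpa using hr),
        Set.indicator_of_notMem (by simpa using hrc), mul_zero]
  have h2 : ∫⁻ r, ψ (r * c) = ENNReal.ofReal c⁻¹ * ∫⁻ r, ψ r := by
    rw [← lintegral_map hψm (by fun_prop : Measurable fun r : ℝ => r * c),
      Real.map_volume_mul_right hc.ne', lintegral_smul_measure, abs_of_pos (inv_pos.2 hc),
      smul_eq_mul]
  rw [← lintegral_indicator measurableSet_Ioi, ← lintegral_indicator measurableSet_Ioi,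
    lintegral_congr h1, lintegral_const_mul _ (by fun_prop), h2, ← mul_assoc,
    ← ENNReal.ofReal_mul (by positivity), ← rpow_neg_one c, ← rpow_add hc, neg_add]

/-- Change of variables from the pre-collisional to the post-collisional relative velocity. -/
lemma lintegral_postcollisional [Nontrivial E] (γ : ℝ) (K : ℝ → ℝ≥0∞) (hK : Measurable K)
    (hK1 : K (-1) = 0) {u : E} (hu : ‖u‖ = 1)
    (hfin : ∫⁻ x, K ⟪x, u⟫ *
      ENNReal.ofReal (((1 + ⟪x, u⟫) / 2) ^ (-((Module.finrank ℝ E + γ) / 2)))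
      ∂surfaceMeasure E ≠ ∞) (h : E → ℝ≥0∞) (hh : Measurable h) :
    ∫⁻ z : E, (∫⁻ σ, ENNReal.ofReal (‖z‖ ^ γ) * K ⟪‖z‖⁻¹ • z, σ⟫ *
        h ((2 : ℝ)⁻¹ • (z + ‖z‖ • σ)) ∂surfaceMeasure E) =
      (∫⁻ x, K ⟪x, u⟫ * ENNReal.ofReal (((1 + ⟪x, u⟫) / 2) ^ (-((Module.finrank ℝ E + γ) / 2)))
        ∂surfaceMeasure E) * ∫⁻ z, ENNReal.ofReal (‖z‖ ^ γ) * h z := by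
  set μ := surfaceMeasure E with hμ
  set p : ℝ := (Module.finrank ℝ E : ℝ) - 1 + γ with hp
  have hd : 1 ≤ Module.finrank ℝ E := Module.finrank_pos
  set F : E → ℝ≥0∞ := fun n => ∫⁻ r in Set.Ioi (0 : ℝ), ENNReal.ofReal (r ^ p) * h (r • n) with hF
  have hFm : Measurable F := Measurable.lintegral_prod_right (by fun_prop)
  have hpow : ∀ r : ℝ, 0 < r → ENNReal.ofReal (r ^ (Module.finrank ℝ E - 1)) *
      ENNReal.ofReal (r ^ γ) = ENNReal.ofReal (r ^ p) := by
    intro r hr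
    rw [← ENNReal.ofReal_mul (by positivity), hp, rpow_add hr, ← rpow_natCast, Nat.cast_sub hd,
      Nat.cast_one]
  have hinner : ∀ ω σ : E, ‖ω‖ = 1 → ‖σ‖ = 1 →
      ∫⁻ r in Set.Ioi (0 : ℝ), ENNReal.ofReal (r ^ p) * (K ⟪ω, σ⟫ * h ((r * 2⁻¹) • (ω + σ))) =
        K ⟪σ, ω⟫ * ENNReal.ofReal (((1 + ⟪σ, ω⟫) / 2) ^ (-((Module.finrank ℝ E + γ) / 2))) *
          F (‖ω + σ‖⁻¹ • (ω + σ)) := by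
    intro ω σ hω hσ
    have hm : Measurable fun r : ℝ => ENNReal.ofReal (r ^ p) * h ((r * 2⁻¹) • (ω + σ)) := by
      fun_prop
    simp_rw [mul_left_comm _ (K ⟪ω, σ⟫)]
    rw [lintegral_const_mul _ hm, real_inner_comm, mul_assoc]
    by_cases hs : ω + σ = 0
    · rw [eq_neg_of_add_eq_zero_right hs, inner_neg_left, real_inner_self_eq_norm_sq, hω]
      simp [hK1]
    congr 1
    have hc : 0 < ‖ω + σ‖ / 2 := by positivity
    have hsq : (1 + ⟪σ, ω⟫) / 2 = (‖ω + σ‖ / 2) ^ (2 : ℝ) := by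
      rw [rpow_two, div_pow, norm_add_sq_real, hω, hσ, real_inner_comm]
      ring
    have hexp : ((1 + ⟪σ, ω⟫) / 2) ^ (-((Module.finrank ℝ E + γ) / 2)) =
        (‖ω + σ‖ / 2) ^ (-(p + 1)) := by
      rw [hsq, ← rpow_mul hc.le, hp]
      congr 1
      ring
    rw [hexp, hF, ← lintegral_Ioi_rpow_mul_comp_mul_right p hc
      (fun r => h (r • (‖ω + σ‖⁻¹ • (ω + σ)))) (by fun_prop)]
    refine lintegral_congr fun r => ?_
    rw [smul_smul]
    congr 3
    field_simp
  have hR : ∫⁻ z, ENNReal.ofReal (‖z‖ ^ γ) * h z = ∫⁻ ω, F ω ∂μ := by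
    rw [lintegral_eq_lintegral_surfaceMeasure _ (by fun_prop)]
    refine lintegral_congr_ae ?_
    filter_upwards [ae_surfaceMeasure_norm_eq_one] with ω hω
    refine setLIntegral_congr_fun measurableSet_Ioi fun r hr => ?_
    have hr : 0 < r := hr
    simp only [norm_smul, hω, mul_one, norm_of_nonneg hr.le]
    rw [← mul_assoc, hpow r hr]
  rw [hR, ← lintegral_bisector (fun s => K s *
      ENNReal.ofReal (((1 + s) / 2) ^ (-((Module.finrank ℝ E + γ) / 2)))) (by fun_prop)
      (by simp [hK1]) hu hfin F hFm,
    lintegral_eq_lintegral_surfaceMeasure _ (Measurable.lintegral_prod_right (by fun_prop))]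
  refine lintegral_congr_ae ?_
  filter_upwards [ae_surfaceMeasure_norm_eq_one] with ω hω
  calc ∫⁻ r in Set.Ioi (0 : ℝ), ENNReal.ofReal (r ^ (Module.finrank ℝ E - 1)) *
        ∫⁻ σ, ENNReal.ofReal (‖r • ω‖ ^ γ) * K ⟪‖r • ω‖⁻¹ • r • ω, σ⟫ *
          h ((2 : ℝ)⁻¹ • (r • ω + ‖r • ω‖ • σ)) ∂μ
      = ∫⁻ r in Set.Ioi (0 : ℝ), ∫⁻ σ, ENNReal.ofReal (r ^ p) *
          (K ⟪ω, σ⟫ * h ((r * 2⁻¹) • (ω + σ))) ∂μ := by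
        refine setLIntegral_congr_fun measurableSet_Ioi fun r hr => ?_
        have hr : 0 < r := hr
        simp only [norm_smul, hω, mul_one, norm_of_nonneg hr.le, smul_smul, ← smul_add,
          inv_mul_cancel₀ hr.ne', one_smul, mul_assoc]
        rw [lintegral_const_mul _ (by fun_prop), ← mul_assoc, hpow r hr,
          lintegral_const_mul _ (by fun_prop), mul_comm r]
    _ = ∫⁻ σ, (∫⁻ r in Set.Ioi (0 : ℝ), ENNReal.ofReal (r ^ p) *
          (K ⟪ω, σ⟫ * h ((r * 2⁻¹) • (ω + σ)))) ∂μ := by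
        refine lintegral_lintegral_swap (Measurable.aemeasurable ?_)
        unfold Function.uncurry
        fun_prop
    _ = _ := by
        refine lintegral_congr_ae ?_
        filter_upwards [ae_surfaceMeasure_norm_eq_one] with σ hσ
        exact hinner ω σ hω hσ

end SurfaceMeasure

section Estimates

lemma rpow_neg_half_one_add_bounds {a : ℝ} (ha : 0 ≤ a) {m : ℕ} (ham : a ≤ m) {s : ℝ}
    (hs : s ∈ Set.Icc (0 : ℝ) 1) :
    1 ≤ ((1 + s) / 2) ^ (-a) ∧ ((1 + s) / 2) ^ (-a) ≤ 2 ^ m ∧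
      ((1 + s) / 2) ^ (-a) - 1 ≤ 2 ^ m * m * (1 - s) := by
  obtain ⟨hs0, hs1⟩ := hs
  set t := (1 + s) / 2 with ht
  have ht0 : 0 < t := by linarith
  have ht1 : t ≤ 1 := by linarith
  have hle : t ^ (-a) ≤ (t ^ m)⁻¹ := by
    rw [← rpow_natCast, ← rpow_neg ht0.le]
    exact rpow_le_rpow_of_exponent_ge ht0 ht1 (neg_le_neg ham)
  have hinv : (t ^ m)⁻¹ ≤ 2 ^ m := by
    rw [← inv_pow]
    gcongr
    rw [inv_le_comm₀ ht0 two_pos]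
    linarith
  refine ⟨one_le_rpow_of_pos_of_le_one_of_nonpos ht0 ht1 (neg_nonpos.2 ha), hle.trans hinv, ?_⟩
  have hbern : 1 - t ^ m ≤ m * (1 - t) := by
    have := one_add_mul_le_pow (a := t - 1) (by linarith) m
    rw [add_sub_cancel] at this
    linarith
  calc t ^ (-a) - 1 ≤ (t ^ m)⁻¹ - 1 := by gcongr
    _ = (t ^ m)⁻¹ * (1 - t ^ m) := by
      rw [mul_sub, inv_mul_cancel₀ (by positivity), mul_one]
    _ ≤ 2 ^ m * (m * (1 - t)) := by
      refine mul_le_mul hinv hbern ?_ (by positivity)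
      exact sub_nonneg.2 (pow_le_one₀ ht0.le ht1)
    _ ≤ 2 ^ m * (m * (1 - s)) := by
      gcongr
      linarith
    _ = 2 ^ m * m * (1 - s) := by ring

lemma norm_sub_rpow_le {E : Type*} [NormedAddCommGroup E] {γ : ℝ} (hγ : γ ∈ Set.Icc (0 : ℝ) 1)
    (v w : E) :
    ‖v - w‖ ^ γ ≤ 2 * (1 + ‖v‖ ^ 2) ^ (γ / 2) * (1 + ‖w‖ ^ 2) := by
  obtain ⟨h0, h1⟩ := hγ
  have hsq : ‖v - w‖ ^ 2 ≤ 2 * (1 + ‖v‖ ^ 2) * (1 + ‖w‖ ^ 2) := by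
    have h := pow_le_pow_left₀ (norm_nonneg _) (norm_sub_le v w) 2
    nlinarith [sq_nonneg (‖v‖ - ‖w‖), mul_nonneg (sq_nonneg ‖v‖) (sq_nonneg ‖w‖)]
  calc ‖v - w‖ ^ γ = (‖v - w‖ ^ 2) ^ (γ / 2) := by
        rw [← rpow_two, ← rpow_mul (norm_nonneg _)]
        congr 1
        ring
    _ ≤ (2 * (1 + ‖v‖ ^ 2) * (1 + ‖w‖ ^ 2)) ^ (γ / 2) :=
        rpow_le_rpow (by positivity) hsq (by positivity)
    _ = 2 ^ (γ / 2) * (1 + ‖v‖ ^ 2) ^ (γ / 2) * (1 + ‖w‖ ^ 2) ^ (γ / 2) := by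
        rw [mul_rpow (by positivity) (by positivity), mul_rpow (by positivity) (by positivity)]
    _ ≤ 2 * (1 + ‖v‖ ^ 2) ^ (γ / 2) * (1 + ‖w‖ ^ 2) := by
        gcongr
        · exact rpow_le_self_of_one_le one_le_two (by linarith)
        · exact rpow_le_self_of_one_le (by nlinarith [sq_nonneg ‖w‖]) (by linarith)

lemma integrable_and_integral_eq_of_lintegral {α : Type*} [MeasurableSpace α] {μ : Measure α}
    {f : α → ℝ} (hf : Measurable f) (hf0 : ∀ x, 0 ≤ f x) {c : ℝ} (hc : 0 ≤ c)
    (h : ∫⁻ x, ENNReal.ofReal (f x) ∂μ = ENNReal.ofReal c) :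
    Integrable f μ ∧ ∫ x, f x ∂μ = c := by
  refine ⟨⟨hf.aestronglyMeasurable, ?_⟩, ?_⟩
  · rw [hasFiniteIntegral_iff_ofReal (.of_forall hf0), h]
    exact ENNReal.ofReal_lt_top
  · rw [integral_eq_lintegral_of_nonneg_ae (.of_forall hf0) hf.aestronglyMeasurable, h,
      ENNReal.toReal_ofReal hc]

end Estimates

section CollisionIntegrals

variable {d : ℕ}

lemma inner_sphere_mem_Icc (σ : Metric.sphere (0 : Vd d) 1) {u : Vd d} (hu : ‖u‖ = 1) :
    ⟪(σ : Vd d), u⟫ ∈ Set.Icc (-1 : ℝ) 1 := by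
  have h := abs_real_inner_le_norm (σ : Vd d) u
  rw [hu, norm_eq_of_mem_sphere, mul_one] at h
  exact abs_le.1 h

lemma measurable_cosTheta (v : Vd d) :
    Measurable fun p : Vd d × Metric.sphere (0 : Vd d) 1 => cosTheta d v p.1 p.2 := by
  unfold cosTheta
  fun_prop

lemma measurable_vPostStar (v : Vd d) :
    Measurable fun p : Vd d × Metric.sphere (0 : Vd d) 1 => vPostStar d v p.1 p.2 := by
  unfold vPostStar
  fun_prop

instance : IsFiniteMeasure (sphMeas d) := by
  unfold sphMeas; infer_instance

lemma lintegral_loss [Nontrivial (Vd d)] {γ : ℝ} {b : ℝ → ℝ} (hb : Measurable b)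
    (hb0 : ∀ s, 0 ≤ b s) {u : Vd d} (hu : ‖u‖ = 1)
    (hbi : Integrable (fun σ : Metric.sphere (0 : Vd d) 1 => b ⟪(σ : Vd d), u⟫) (sphMeas d))
    {g : Vd d → ℝ} (hg : Measurable g) (hg0 : ∀ w, 0 ≤ g w) (v : Vd d)
    (hI : Integrable fun w => ‖v - w‖ ^ γ * g w) :
    ∫⁻ p : Vd d × Metric.sphere (0 : Vd d) 1,
        ENNReal.ofReal (‖v - p.1‖ ^ γ * b (cosTheta d v p.1 p.2) * g p.1)
        ∂(volume.prod (sphMeas d)) =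
      ENNReal.ofReal ((∫ σ : Metric.sphere (0 : Vd d) 1, b ⟪(σ : Vd d), u⟫ ∂(sphMeas d)) *
        ∫ w, ‖v - w‖ ^ γ * g w) := by
  have hcos := measurable_cosTheta v
  have hKm : Measurable fun s => ENNReal.ofReal (b s) := by fun_prop
  rw [lintegral_prod _ (by fun_prop), ENNReal.ofReal_mul (integral_nonneg fun _ => hb0 _),
    ofReal_integral_eq_lintegral_ofReal hbi (.of_forall fun _ => hb0 _),
    ofReal_integral_eq_lintegral_ofReal hI
      (.of_forall fun w => mul_nonneg (by positivity) (hg0 w)),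
    ← lintegral_const_mul _ (by fun_prop)]
  refine lintegral_congr_ae ?_
  filter_upwards [(measure_singleton v : volume ({v} : Set (Vd d)) = 0) |> compl_mem_ae_iff.2]
    with w hw
  have hvw : ‖v - w‖ ≠ 0 := norm_ne_zero_iff.2 (sub_ne_zero.2 (Ne.symm hw))
  have hunit : ‖‖v - w‖⁻¹ • (v - w)‖ = 1 := by
    rw [norm_smul, norm_inv, norm_norm, inv_mul_cancel₀ hvw]
  have hrot := lintegral_inner_surfaceMeasure_eq _ hKm (hu.trans hunit.symm)
  rw [lintegral_surfaceMeasure _ (by fun_prop), lintegral_surfaceMeasure _ (by fun_prop)] at hrot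
  unfold sphMeas
  rw [hrot, mul_comm, ← lintegral_const_mul _ (by fun_prop)]
  refine lintegral_congr fun σ => ?_
  have hnn : 0 ≤ ‖v - w‖ ^ γ * g w := mul_nonneg (by positivity) (hg0 w)
  rw [← ENNReal.ofReal_mul hnn, cosTheta, real_inner_comm]
  congr 1
  ring

lemma lintegral_gain [Nontrivial (Vd d)] {γ : ℝ} {b : ℝ → ℝ} (hb : Measurable b)
    (hb0 : ∀ s, 0 ≤ b s) (hb1 : b (-1) = 0) {u : Vd d} (hu : ‖u‖ = 1)
    (hbi : Integrable (fun σ : Metric.sphere (0 : Vd d) 1 =>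
      b ⟪(σ : Vd d), u⟫ * ((1 + ⟪(σ : Vd d), u⟫) / 2) ^ (-((d + γ) / 2))) (sphMeas d))
    {g : Vd d → ℝ} (hg : Measurable g) (hg0 : ∀ w, 0 ≤ g w) (v : Vd d)
    (hI : Integrable fun w => ‖v - w‖ ^ γ * g w) :
    ∫⁻ p : Vd d × Metric.sphere (0 : Vd d) 1,
        ENNReal.ofReal (‖v - p.1‖ ^ γ * b (cosTheta d v p.1 p.2) * g (vPostStar d v p.1 p.2))
        ∂(volume.prod (sphMeas d)) =
      ENNReal.ofReal ((∫ σ : Metric.sphere (0 : Vd d) 1,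
          b ⟪(σ : Vd d), u⟫ * ((1 + ⟪(σ : Vd d), u⟫) / 2) ^ (-((d + γ) / 2)) ∂(sphMeas d)) *
        ∫ w, ‖v - w‖ ^ γ * g w) := by
  have hcos := measurable_cosTheta v
  have hpost := measurable_vPostStar v
  have hnn : ∀ σ : Metric.sphere (0 : Vd d) 1,
      0 ≤ b ⟪(σ : Vd d), u⟫ * ((1 + ⟪(σ : Vd d), u⟫) / 2) ^ (-((d + γ) / 2)) := fun σ =>
    mul_nonneg (hb0 _) (rpow_nonneg (by linarith [(inner_sphere_mem_Icc σ hu).1]) _)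
  have hkernel : ∫⁻ x, ENNReal.ofReal (b ⟪x, u⟫) *
      ENNReal.ofReal (((1 + ⟪x, u⟫) / 2) ^ (-((Module.finrank ℝ (Vd d) + γ) / 2)))
      ∂surfaceMeasure (Vd d) = ENNReal.ofReal (∫ σ : Metric.sphere (0 : Vd d) 1,
        b ⟪(σ : Vd d), u⟫ * ((1 + ⟪(σ : Vd d), u⟫) / 2) ^ (-((d + γ) / 2)) ∂(sphMeas d)) := by
    rw [lintegral_surfaceMeasure _ (by fun_prop),
      ofReal_integral_eq_lintegral_ofReal hbi (.of_forall hnn)]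
    refine lintegral_congr fun σ => ?_
    rw [← ENNReal.ofReal_mul (hb0 _), finrank_euclideanSpace_fin]
  have hchange := lintegral_postcollisional γ (fun s => ENNReal.ofReal (b s)) (by fun_prop)
    (by simp [hb1]) hu (by rw [hkernel]; exact ENNReal.ofReal_ne_top)
    (fun z => ENNReal.ofReal (g (v - z))) (by fun_prop)
  have hint : ∫⁻ z : Vd d, ENNReal.ofReal (‖z‖ ^ γ) * ENNReal.ofReal (g (v - z)) =
      ENNReal.ofReal (∫ w, ‖v - w‖ ^ γ * g w) := by
    rw [ofReal_integral_eq_lintegral_ofReal hI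
      (.of_forall fun w => mul_nonneg (by positivity) (hg0 w)),
      ← lintegral_sub_left_eq_self _ v]
    refine lintegral_congr fun z => ?_
    rw [sub_sub_cancel, ENNReal.ofReal_mul (by positivity)]
  rw [hkernel, hint, ← ENNReal.ofReal_mul (integral_nonneg hnn)] at hchange
  rw [← hchange, lintegral_prod _ (by fun_prop), ← lintegral_sub_left_eq_self _ v]
  refine lintegral_congr fun z => ?_
  rw [lintegral_surfaceMeasure _ (by fun_prop)]
  refine lintegral_congr fun σ => ?_
  have hpost_eq : vPostStar d v (v - z) σ = v - (2 : ℝ)⁻¹ • (z + ‖z‖ • (σ : Vd d)) := by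
    rw [vPostStar, sub_sub_cancel]
    module
  rw [hpost_eq, cosTheta, sub_sub_cancel, ENNReal.ofReal_mul (mul_nonneg (by positivity) (hb0 _)),
    ENNReal.ofReal_mul (by positivity)]

end CollisionIntegrals

/-- L∞ bound on the linear operator `S` via the `(1 - cos θ)`-moment of the angular
kernel (Lemma 4.1, hard-potential case).  The double integral defining `S[g](v)` is
formalized as an integral against the product measure; absolute convergence is the
corresponding integrability statement. -/
theorem S_operator_bound
    (d : ℕ) (hd : 2 ≤ d) (γ : ℝ) (hγ : γ ∈ Set.Icc (0 : ℝ) 1) :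
    ∃ cst : ℝ, 0 < cst ∧
      ∀ b : ℝ → ℝ, Measurable b → (∀ s : ℝ, 0 ≤ b s) → (∀ s : ℝ, s < 0 → b s = 0) →
        (∀ u : Vd d, ‖u‖ = 1 →
          Integrable (fun σ : Metric.sphere (0 : Vd d) 1 => b ⟪(σ : Vd d), u⟫) (sphMeas d)) →
      ∀ mb : ℝ,
        (∀ u : Vd d, ‖u‖ = 1 →
          (∫ σ : Metric.sphere (0 : Vd d) 1,
            b ⟪(σ : Vd d), u⟫ * (1 - ⟪(σ : Vd d), u⟫) ∂(sphMeas d)) = mb) →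
      ∀ g : Vd d → ℝ, Measurable g → (∀ w : Vd d, 0 ≤ g w) →
        (Integrable fun w : Vd d => (1 + ‖w‖ ^ 2) * g w) →
      ∀ v : Vd d,
        Integrable
          (fun p : Vd d × Metric.sphere (0 : Vd d) 1 =>
            ‖v - p.1‖ ^ γ * b (cosTheta d v p.1 p.2) * (g p.1 - g (vPostStar d v p.1 p.2)))
          (volume.prod (sphMeas d)) ∧
        |∫ p : Vd d × Metric.sphere (0 : Vd d) 1,
            ‖v - p.1‖ ^ γ * b (cosTheta d v p.1 p.2) * (g p.1 - g (vPostStar d v p.1 p.2))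
            ∂(volume.prod (sphMeas d))| ≤
          cst * mb * (∫ w : Vd d, (1 + ‖w‖ ^ 2) * g w) * (1 + ‖v‖ ^ 2) ^ (γ / 2) := by
  have : Nonempty (Fin d) := ⟨⟨0, by omega⟩⟩
  have : Nontrivial (Vd d) := inferInstance
  obtain ⟨u, hu⟩ := exists_norm_eq (Vd d) zero_le_one
  refine ⟨2 * (2 ^ (d + 1) * (d + 1 : ℕ)), by positivity, ?_⟩
  intro b hb hb0 hbneg hbint mb hmb g hg hg0 hgint v
  have hbi := hbint u hu
  set a : ℝ := (d + γ) / 2 with ha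
  have ha0 : 0 ≤ a := by linarith [hγ.1, (Nat.cast_nonneg d : (0 : ℝ) ≤ d)]
  have ham : a ≤ (d + 1 : ℕ) := by
    push_cast
    linarith [hγ.2, (Nat.cast_nonneg d : (0 : ℝ) ≤ d)]
  set C : ℝ := 2 ^ (d + 1) * (d + 1 : ℕ) with hC
  set W : ℝ → ℝ := fun s => ((1 + s) / 2) ^ (-a) with hW
  have hWbounds : ∀ σ : Metric.sphere (0 : Vd d) 1,
      b ⟪(σ : Vd d), u⟫ ≤ b ⟪(σ : Vd d), u⟫ * W ⟪(σ : Vd d), u⟫ ∧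
      b ⟪(σ : Vd d), u⟫ * W ⟪(σ : Vd d), u⟫ ≤ 2 ^ (d + 1) * b ⟪(σ : Vd d), u⟫ ∧
      b ⟪(σ : Vd d), u⟫ * W ⟪(σ : Vd d), u⟫ - b ⟪(σ : Vd d), u⟫ ≤
        C * (b ⟪(σ : Vd d), u⟫ * (1 - ⟪(σ : Vd d), u⟫)) := by
    intro σ
    rcases lt_or_ge ⟪(σ : Vd d), u⟫ 0 with hs | hs
    · simp [hbneg _ hs]
    obtain ⟨h1, h2, h3⟩ :=
      rpow_neg_half_one_add_bounds ha0 ham ⟨hs, (inner_sphere_mem_Icc σ hu).2⟩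
    have hbs := hb0 ⟪(σ : Vd d), u⟫
    refine ⟨le_mul_of_one_le_right hbs h1, ?_, ?_⟩
    · rw [mul_comm]
      exact mul_le_mul_of_nonneg_right h2 hbs
    · have := mul_le_mul_of_nonneg_left h3 hbs
      linarith
  have hbWi : Integrable (fun σ : Metric.sphere (0 : Vd d) 1 =>
      b ⟪(σ : Vd d), u⟫ * W ⟪(σ : Vd d), u⟫) (sphMeas d) := by
    refine (hbi.const_mul (2 ^ (d + 1))).mono' (by fun_prop) (.of_forall fun σ => ?_)
    rw [norm_of_nonneg ((hb0 _).trans (hWbounds σ).1)]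
    exact (hWbounds σ).2.1
  have hbmi : Integrable (fun σ : Metric.sphere (0 : Vd d) 1 =>
      b ⟪(σ : Vd d), u⟫ * (1 - ⟪(σ : Vd d), u⟫)) (sphMeas d) := by
    refine (hbi.const_mul 2).mono' (by fun_prop) (.of_forall fun σ => ?_)
    obtain ⟨h1, h2⟩ := inner_sphere_mem_Icc σ hu
    rw [norm_of_nonneg (mul_nonneg (hb0 _) (by linarith)), mul_comm]
    exact mul_le_mul_of_nonneg_right (by linarith) (hb0 _)
  set N := ∫ σ : Metric.sphere (0 : Vd d) 1, b ⟪(σ : Vd d), u⟫ ∂(sphMeas d) with hN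
  set N' := ∫ σ : Metric.sphere (0 : Vd d) 1,
    b ⟪(σ : Vd d), u⟫ * W ⟪(σ : Vd d), u⟫ ∂(sphMeas d) with hN'
  have hN0 : 0 ≤ N := integral_nonneg fun _ => hb0 _
  have hNN' : N ≤ N' := integral_mono hbi hbWi fun σ => (hWbounds σ).1
  have hdiff : N' - N ≤ C * mb := by
    rw [← hmb u hu, ← integral_const_mul, hN, hN', ← integral_sub hbWi hbi]
    exact integral_mono (hbWi.sub hbi) (hbmi.const_mul C) fun σ => (hWbounds σ).2.2
  set I := ∫ w, ‖v - w‖ ^ γ * g w with hI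
  have hIle : ∀ w, ‖v - w‖ ^ γ * g w ≤
      2 * (1 + ‖v‖ ^ 2) ^ (γ / 2) * ((1 + ‖w‖ ^ 2) * g w) := fun w =>
    (mul_le_mul_of_nonneg_right (norm_sub_rpow_le hγ v w) (hg0 w)).trans_eq (mul_assoc _ _ _)
  have hI0 : ∀ w, 0 ≤ ‖v - w‖ ^ γ * g w := fun w => mul_nonneg (by positivity) (hg0 w)
  have hIi : Integrable fun w => ‖v - w‖ ^ γ * g w := by
    refine (hgint.const_mul (2 * (1 + ‖v‖ ^ 2) ^ (γ / 2))).mono' (by fun_prop)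
      (.of_forall fun w => ?_)
    rw [norm_of_nonneg (hI0 w)]
    exact hIle w
  have hInn : 0 ≤ I := integral_nonneg hI0
  have hIbound : I ≤ 2 * (1 + ‖v‖ ^ 2) ^ (γ / 2) * ∫ w : Vd d, (1 + ‖w‖ ^ 2) * g w := by
    rw [← integral_const_mul]
    exact integral_mono hIi (hgint.const_mul _) hIle
  have hcos := measurable_cosTheta v
  have hpost := measurable_vPostStar v
  obtain ⟨hLi, hL⟩ := integrable_and_integral_eq_of_lintegral (by fun_prop)
    (fun p => mul_nonneg (mul_nonneg (by positivity) (hb0 _)) (hg0 _)) (mul_nonneg hN0 hInn)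
    (lintegral_loss hb hb0 hu hbi hg hg0 v hIi)
  obtain ⟨hGi, hG⟩ := integrable_and_integral_eq_of_lintegral (by fun_prop)
    (fun p => mul_nonneg (mul_nonneg (by positivity) (hb0 _)) (hg0 _))
    (mul_nonneg (hN0.trans hNN') hInn)
    (lintegral_gain hb hb0 (hbneg _ (by norm_num)) hu hbWi hg hg0 v hIi)
  simp only [mul_sub]
  refine ⟨hLi.sub hGi, ?_⟩
  rw [integral_sub hLi hGi, hL, hG, ← sub_mul, abs_mul, abs_of_nonneg hInn, abs_sub_comm,
    abs_of_nonneg (sub_nonneg.2 hNN')]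
  calc (N' - N) * I ≤ (C * mb) * (2 * (1 + ‖v‖ ^ 2) ^ (γ / 2) *
        ∫ w : Vd d, (1 + ‖w‖ ^ 2) * g w) :=
      mul_le_mul hdiff hIbound hInn ((sub_nonneg.2 hNN').trans hdiff)
    _ = _ := by ring

end
end

section
/- L∞ bound on the non-cutoff gain-type bilinear operator Q¹ via the (1 − cos θ)-moment (Lemma 4.2, case 2+γ ≥ 0 with γ ≥ 0). Let d ≥ 2 be an integer, γ ∈ [0,1], and set γ̃ = 2 + γ. Let b : [−1,1] → [0,∞) be measurable with b(s) = 0 for s < 0 and n_b < ∞. Let g : ℝ^d → ℝ be measurable with ‖g‖_{L¹_{γ̃}} := ∫_{ℝ^d} ⟨w⟩^{γ̃} |g(w)| dw < ∞, and let f : ℝ^d → ℝ be twice continuously differentiable with ‖f‖_{W^{2,∞}} := max over all partial derivatives ∂^α f with |α| ≤ 2 of sup_{v∈ℝ^d} |∂^α f(v)| < ∞. Define Q¹_b(g,f)(v) = ∫_{ℝ^d} ∫_{S^{d−1}} |v−v_*|^γ b(cos θ) g(v'_*) ( f(v') − f(v) ) dσ dv_*. Then this integral converges absolutely for every v ∈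 ℝ^d, and there exists a constant cst > 0, depending only on d and γ, such that |Q¹_b(g,f)(v)| ≤ cst · m_b · ‖g‖_{L¹_{γ̃}} · ‖f‖_{W^{2,∞}} · ⟨v⟩^{γ̃} for all v ∈ ℝ^d. -/
open MeasureTheory Real
open scoped RealInnerProductSpace ENNReal

noncomputable section

section

variable {E : Type*} [NormedAddCommGroup E] [InnerProductSpace ℝ E] [FiniteDimensional ℝ E]
  [MeasurableSpace E] [BorelSpace E]

/-- The action of a linear isometry on the unit sphere. -/
def sphereMap (e : E ≃ₗᵢ[ℝ] E) (σ : Metric.sphere (0 : E) 1) : Metric.sphere (0 : E) 1 :=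
  ⟨e σ, by simp⟩

omit [FiniteDimensional ℝ E] in
lemma measurable_sphereMap (e : E ≃ₗᵢ[ℝ] E) : Measurable (sphereMap e) :=
  (e.continuous.measurable.comp measurable_subtype_coe).subtype_mk

open scoped Pointwise in
lemma measurePreserving_sphereMap (e : E ≃ₗᵢ[ℝ] E) :
    MeasurePreserving (sphereMap e) (volume : Measure E).toSphere
      (volume : Measure E).toSphere := by
  refine ⟨measurable_sphereMap e, ?_⟩
  ext s hs
  rw [Measure.map_apply (measurable_sphereMap e) hs,
    Measure.toSphere_apply' _ (measurable_sphereMap e hs), Measure.toSphere_apply' _ hs]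
  congr 1
  rw [← e.measurePreserving.measure_preimage_emb e.toHomeomorph.measurableEmbedding
    (Set.Ioo (0 : ℝ) 1 • (Subtype.val '' s))]
  congr 1
  ext x
  simp only [Set.mem_smul, Set.mem_image, Set.mem_preimage]
  constructor
  · rintro ⟨r, hr, _, ⟨σ, hσ, rfl⟩, rfl⟩
    exact ⟨r, hr, _, ⟨_, hσ, rfl⟩, by simp [sphereMap]⟩
  · rintro ⟨r, hr, _, ⟨σ, hσ, rfl⟩, h⟩
    refine ⟨r, hr, _, ⟨sphereMap e.symm σ, ?_, rfl⟩, ?_⟩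
    · simpa [sphereMap] using hσ
    · apply e.injective
      simp [sphereMap, ← h]

instance compactSpace_unitary : CompactSpace (unitary (E →L[ℝ] E)) := by
  refine isCompact_iff_compactSpace.mp ?_
  refine Metric.isCompact_of_isClosed_isBounded (isClosed_unitary) ?_
  refine (Metric.isBounded_closedBall (x := 0) (r := 1)).subset fun u hu => ?_
  rw [mem_closedBall_zero_iff]
  refine ContinuousLinearMap.opNorm_le_bound _ zero_le_one fun x => ?_
  rw [one_mul]
  exact (u.norm_map_of_mem_unitary hu x).le

/-- Polar coordinates: `(ω, r) ↦ r ω` carries the product of the surface measure and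
`r ^ (dim E - 1) dr` to Lebesgue measure. -/
lemma measurePreserving_polar [Nontrivial E] :
    MeasurePreserving (fun p : Metric.sphere (0 : E) 1 × Set.Ioi (0 : ℝ) => (p.2 : ℝ) • (p.1 : E))
      ((volume : Measure E).toSphere.prod (.volumeIoiPow (Module.finrank ℝ E - 1))) volume := by
  have h1 := ((volume : Measure E).measurePreserving_homeomorphUnitSphereProd).symm
    (homeomorphUnitSphereProd E).toMeasurableEquiv
  have h2 : MeasurePreserving (Subtype.val : ({0}ᶜ : Set E) → E)
    ((volume : Measure E).comap (↑)) volume := by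
    refine ⟨measurable_subtype_coe, ?_⟩
    rw [map_comap_subtype_coe (measurableSet_singleton _).compl, Measure.restrict_eq_self_of_ae_mem]
    simp [ae_iff]
  exact h2.comp h1

lemma measurable_unitary_inv_apply :
    Measurable fun p : unitary (E →L[ℝ] E) × E => ((p.1⁻¹ : unitary (E →L[ℝ] E)) : E →L[ℝ] E) p.2 := by
  have : Continuous fun p : unitary (E →L[ℝ] E) × E => ((p.1⁻¹ : unitary (E →L[ℝ] E)) : E →L[ℝ] E) p.2 := by
    fun_prop
  exact this.measurable

omit [MeasurableSpace E] [BorelSpace E] in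
lemma exists_unitary_apply_eq {x y : E} (h : ‖x‖ = ‖y‖) :
    ∃ u : unitary (E →L[ℝ] E), (u : E →L[ℝ] E) x = y := by
  refine ⟨Unitary.linearIsometryEquiv.symm (Submodule.reflection (ℝ ∙ (x - y))ᗮ), ?_⟩
  simpa using Submodule.reflection_sub h

omit [MeasurableSpace E] [BorelSpace E] in
lemma unitary_inv_apply_apply (u : unitary (E →L[ℝ] E)) (x : E) :
    ((u⁻¹ : unitary (E →L[ℝ] E)) : E →L[ℝ] E) ((u : E →L[ℝ] E) x) = x :=
  (Unitary.linearIsometryEquiv u).symm_apply_apply x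

omit [MeasurableSpace E] [BorelSpace E] in
lemma lintegral_unitary_inv_apply_eq (μ : Measure (unitary (E →L[ℝ] E))) [μ.IsMulLeftInvariant]
    (K : E → ℝ≥0∞) {x y : E} (h : ‖x‖ = ‖y‖) :
    ∫⁻ u, K (((u⁻¹ : unitary (E →L[ℝ] E)) : E →L[ℝ] E) x) ∂μ =
      ∫⁻ u, K (((u⁻¹ : unitary (E →L[ℝ] E)) : E →L[ℝ] E) y) ∂μ := by
  obtain ⟨q, rfl⟩ := exists_unitary_apply_eq h
  rw [← lintegral_mul_left_eq_self (fun u : unitary (E →L[ℝ] E) =>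
    K (((u⁻¹ : unitary (E →L[ℝ] E)) : E →L[ℝ] E) ((q : E →L[ℝ] E) x))) q]
  simp [unitary_inv_apply_apply]

/-- By rotation invariance, conditionally on `⟪ω, σ⟫` the direction of `ω + σ` is uniformly
distributed on the sphere. -/
lemma lintegral_inner_mul_add (B : ℝ → ℝ≥0∞) (hB : Measurable B) (K : E → ℝ≥0∞)
    (hK : Measurable K) :
    (volume : Measure E).toSphere Set.univ *
      ∫⁻ p : Metric.sphere (0 : E) 1 × Metric.sphere (0 : E) 1, B ⟪(p.1 : E), p.2⟫ * K (p.1 + p.2)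
        ∂((volume : Measure E).toSphere.prod (volume : Measure E).toSphere) =
      ∫⁻ p : Metric.sphere (0 : E) 1 × Metric.sphere (0 : E) 1, B ⟪(p.1 : E), p.2⟫ *
        ∫⁻ τ : Metric.sphere (0 : E) 1, K (‖(p.1 : E) + p.2‖ • (τ : E))
          ∂(volume : Measure E).toSphere
        ∂((volume : Measure E).toSphere.prod (volume : Measure E).toSphere) := by
  set ν := (volume : Measure E).toSphere
  let μ : Measure (unitary (E →L[ℝ] E)) := Measure.haarMeasure ⊤
  have hμ : μ Set.univ = 1 := Measure.haarMeasure_self (K₀ := ⊤)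
  have : IsProbabilityMeasure μ := ⟨hμ⟩
  have hinv (x : E) : ν Set.univ * ∫⁻ u, K (((u⁻¹ : unitary (E →L[ℝ] E)) : E →L[ℝ] E) x) ∂μ =
      ∫⁻ τ : Metric.sphere (0 : E) 1, K (‖x‖ • (τ : E)) ∂ν := by
    have h1 (u : unitary (E →L[ℝ] E)) :
        ∫⁻ τ : Metric.sphere (0 : E) 1, K (‖x‖ • (τ : E)) ∂ν =
        ∫⁻ τ : Metric.sphere (0 : E) 1,
          K (((u⁻¹ : unitary (E →L[ℝ] E)) : E →L[ℝ] E) (‖x‖ • (τ : E))) ∂ν := by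
      rw [← (measurePreserving_sphereMap (Unitary.linearIsometryEquiv u⁻¹)).lintegral_comp
        (f := fun τ => K (‖x‖ • (τ : E))) (by fun_prop)]
      simp only [map_smul]
      rfl
    calc _ = ∫⁻ τ : Metric.sphere (0 : E) 1, ∫⁻ u,
          K (((u⁻¹ : unitary (E →L[ℝ] E)) : E →L[ℝ] E) (‖x‖ • (τ : E))) ∂μ ∂ν := by
          rw [mul_comm, ← lintegral_const]
          refine lintegral_congr fun τ => lintegral_unitary_inv_apply_eq _ _ ?_
          simp [norm_smul]
      _ = ∫⁻ u, ∫⁻ τ : Metric.sphere (0 : E) 1,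
          K (((u⁻¹ : unitary (E →L[ℝ] E)) : E →L[ℝ] E) (‖x‖ • (τ : E))) ∂ν ∂μ := by
          refine lintegral_lintegral_swap (Measurable.aemeasurable ?_)
          exact (hK.comp measurable_unitary_inv_apply).comp
            (f := fun p : Metric.sphere (0 : E) 1 × unitary (E →L[ℝ] E) => (p.2, ‖x‖ • (p.1 : E)))
            (by fun_prop)
      _ = _ := by
          simp_rw [← h1]
          simp
  have hrot (u : unitary (E →L[ℝ] E)) :
      ∫⁻ p : Metric.sphere (0 : E) 1 × Metric.sphere (0 : E) 1, B ⟪(p.1 : E), p.2⟫ * K (p.1 + p.2)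
        ∂(ν.prod ν) =
      ∫⁻ p : Metric.sphere (0 : E) 1 × Metric.sphere (0 : E) 1, B ⟪(p.1 : E), p.2⟫ *
        K (((u⁻¹ : unitary (E →L[ℝ] E)) : E →L[ℝ] E) (p.1 + p.2)) ∂(ν.prod ν) := by
    have h := measurePreserving_sphereMap (Unitary.linearIsometryEquiv (u⁻¹ : unitary (E →L[ℝ] E)))
    rw [← (h.prod h).lintegral_comp
      (f := fun p => B ⟪(p.1 : E), p.2⟫ * K (p.1 + p.2)) (by fun_prop)]
    refine lintegral_congr fun p => ?_
    change B ⟪((u⁻¹ : unitary (E →L[ℝ] E)) : E →L[ℝ] E) p.1,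
      ((u⁻¹ : unitary (E →L[ℝ] E)) : E →L[ℝ] E) p.2⟫ *
      K (((u⁻¹ : unitary (E →L[ℝ] E)) : E →L[ℝ] E) p.1 +
        ((u⁻¹ : unitary (E →L[ℝ] E)) : E →L[ℝ] E) p.2) = _
    rw [Unitary.inner_map_map, map_add]
  calc _ = ν Set.univ * ∫⁻ u, (∫⁻ p : Metric.sphere (0 : E) 1 × Metric.sphere (0 : E) 1,
        B ⟪(p.1 : E), p.2⟫ * K (((u⁻¹ : unitary (E →L[ℝ] E)) : E →L[ℝ] E) (p.1 + p.2))
          ∂(ν.prod ν)) ∂μ := by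
        simp_rw [← hrot]
        simp
    _ = ν Set.univ * ∫⁻ p : Metric.sphere (0 : E) 1 × Metric.sphere (0 : E) 1, (∫⁻ u,
        B ⟪(p.1 : E), p.2⟫ * K (((u⁻¹ : unitary (E →L[ℝ] E)) : E →L[ℝ] E) (p.1 + p.2)) ∂μ)
          ∂(ν.prod ν) := by
        rw [lintegral_lintegral_swap (Measurable.aemeasurable ?_)]
        refine Measurable.mul (by fun_prop) ((hK.comp measurable_unitary_inv_apply).comp
            (f := fun p : unitary (E →L[ℝ] E) × Metric.sphere (0 : E) 1 × Metric.sphere (0 : E) 1 =>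
              (p.1, (p.2.1 + p.2.2 : E)))
            (by fun_prop))
    _ = _ := by
        rw [← lintegral_const_mul']
        · refine lintegral_congr fun p => ?_
          rw [← hinv, lintegral_const_mul, mul_left_comm]
          exact (hK.comp measurable_unitary_inv_apply).comp
            (f := fun u : unitary (E →L[ℝ] E) => (u, (p.1 + p.2 : E))) (by fun_prop)
        · exact measure_ne_top _ _

lemma lintegral_comp_smul_le {c : ℝ} (hc : 1 ≤ c) (F : E → ℝ≥0∞) (hF : Measurable F) :
    ∫⁻ x, F (c • x) ≤ ∫⁻ x, F x := by
  have hc0 : c ≠ 0 := by positivity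
  rw [← lintegral_map (f := F) (g := fun x => c • x) hF (by fun_prop),
    Measure.map_addHaar_smul _ hc0, lintegral_smul_measure]
  refine mul_le_of_le_one_left' ?_
  rw [ENNReal.ofReal_le_one, abs_of_nonneg (by positivity)]
  exact inv_le_one_of_one_le₀ (one_le_pow₀ hc)

omit [FiniteDimensional ℝ E] [MeasurableSpace E] [BorelSpace E] in
lemma one_le_norm_add_of_inner_nonneg (p : Metric.sphere (0 : E) 1 × Metric.sphere (0 : E) 1)
    (h : 0 ≤ ⟪(p.1 : E), p.2⟫) : 1 ≤ ‖(p.1 : E) + p.2‖ := by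
  have := norm_add_sq_real (p.1 : E) p.2
  simp only [norm_eq_of_mem_sphere] at this
  nlinarith [norm_nonneg ((p.1 : E) + p.2)]

/-- Integrating out the angle between `ω` and `σ` in the variable `x = r (ω + σ)`. -/
lemma lintegral_polar_add_le [Nontrivial E] (B : ℝ → ℝ≥0∞) (hB : Measurable B)
    (hB0 : ∀ s < 0, B s = 0) (M : ℝ≥0∞)
    (hM : ∀ ω : Metric.sphere (0 : E) 1,
      ∫⁻ σ : Metric.sphere (0 : E) 1, B ⟪(ω : E), σ⟫ ∂(volume : Measure E).toSphere = M)
    {α : ℝ} (hα : 0 ≤ α) (G : E → ℝ≥0∞) (hG : Measurable G) :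
    ∫⁻ q : (Metric.sphere (0 : E) 1 × Metric.sphere (0 : E) 1) × Set.Ioi (0 : ℝ),
        ENNReal.ofReal ((q.2 : ℝ) ^ α) * B ⟪(q.1.1 : E), q.1.2⟫ *
          G ((q.2 : ℝ) • ((q.1.1 : E) + q.1.2))
        ∂(((volume : Measure E).toSphere.prod (volume : Measure E).toSphere).prod
          (.volumeIoiPow (Module.finrank ℝ E - 1))) ≤
      M * ∫⁻ x : E, ENNReal.ofReal (‖x‖ ^ α) * G x := by
  set ν := (volume : Measure E).toSphere with hν
  set κ := Measure.volumeIoiPow (Module.finrank ℝ E - 1)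
  have hν0 : ν Set.univ ≠ 0 := by
    rw [Ne, Measure.measure_univ_eq_zero]
    exact Measure.toSphere_ne_zero _
  rw [← ENNReal.mul_le_mul_iff_right hν0 (measure_ne_top ν _)]
  have hpol (c : ℝ) (hc : 0 ≤ c) : ∫⁻ r : Set.Ioi (0 : ℝ), ∫⁻ τ : Metric.sphere (0 : E) 1,
      ENNReal.ofReal ((r : ℝ) ^ α) * G ((r : ℝ) • c • (τ : E)) ∂ν ∂κ =
      ∫⁻ x : E, ENNReal.ofReal (‖x‖ ^ α) * G (c • x) := by
    rw [← measurePreserving_polar.lintegral_comp (by fun_prop), lintegral_prod_symm _ (by fun_prop)]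
    refine lintegral_congr fun r => lintegral_congr fun τ => ?_
    have hr : (0 : ℝ) < r := r.2
    simp [norm_smul, abs_of_pos hr, smul_comm c]
  calc _ = ∫⁻ r : Set.Ioi (0 : ℝ), ν Set.univ *
        ∫⁻ p : Metric.sphere (0 : E) 1 × Metric.sphere (0 : E) 1, B ⟪(p.1 : E), p.2⟫ *
          (ENNReal.ofReal ((r : ℝ) ^ α) * G ((r : ℝ) • (p.1 + p.2))) ∂(ν.prod ν) ∂κ := by
        rw [lintegral_prod_symm _ (by fun_prop), lintegral_const_mul' _ _ (measure_ne_top ν _)]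
        congr 1
        refine lintegral_congr fun r => lintegral_congr fun p => ?_
        ring
    _ = ∫⁻ r : Set.Ioi (0 : ℝ), ∫⁻ p : Metric.sphere (0 : E) 1 × Metric.sphere (0 : E) 1,
          B ⟪(p.1 : E), p.2⟫ * (∫⁻ τ : Metric.sphere (0 : E) 1,
          ENNReal.ofReal ((r : ℝ) ^ α) * G ((r : ℝ) • ‖(p.1 : E) + p.2‖ • (τ : E)) ∂ν)
          ∂(ν.prod ν) ∂κ := by
        refine lintegral_congr fun r => ?_
        exact lintegral_inner_mul_add B hB
          (fun x => ENNReal.ofReal ((r : ℝ) ^ α) * G ((r : ℝ) • x)) (by fun_prop)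
    _ = ∫⁻ p : Metric.sphere (0 : E) 1 × Metric.sphere (0 : E) 1, ∫⁻ r : Set.Ioi (0 : ℝ),
          B ⟪(p.1 : E), p.2⟫ * (∫⁻ τ : Metric.sphere (0 : E) 1,
          ENNReal.ofReal ((r : ℝ) ^ α) * G ((r : ℝ) • ‖(p.1 : E) + p.2‖ • (τ : E)) ∂ν)
          ∂κ ∂(ν.prod ν) := by
        refine lintegral_lintegral_swap (Measurable.aemeasurable ?_)
        refine Measurable.mul (by fun_prop) (Measurable.lintegral_prod_right' (f := fun z :
          (Set.Ioi (0 : ℝ) × (Metric.sphere (0 : E) 1 × Metric.sphere (0 : E) 1)) ×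
            Metric.sphere (0 : E) 1 => ENNReal.ofReal ((z.1.1 : ℝ) ^ α) *
              G ((z.1.1 : ℝ) • ‖(z.1.2.1 : E) + z.1.2.2‖ • (z.2 : E))) (by fun_prop))
    _ = ∫⁻ p : Metric.sphere (0 : E) 1 × Metric.sphere (0 : E) 1, B ⟪(p.1 : E), p.2⟫ *
          (∫⁻ x : E, ENNReal.ofReal (‖x‖ ^ α) * G (‖(p.1 : E) + p.2‖ • x)) ∂(ν.prod ν) := by
        refine lintegral_congr fun p => ?_
        rw [← hpol _ (norm_nonneg _), lintegral_const_mul]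
        exact Measurable.lintegral_prod_right' (f := fun z :
          (Set.Ioi (0 : ℝ)) × Metric.sphere (0 : E) 1 => ENNReal.ofReal ((z.1 : ℝ) ^ α) *
              G ((z.1 : ℝ) • ‖(p.1 : E) + p.2‖ • (z.2 : E))) (by fun_prop)
    _ ≤ ∫⁻ p : Metric.sphere (0 : E) 1 × Metric.sphere (0 : E) 1, B ⟪(p.1 : E), p.2⟫ *
          (∫⁻ x : E, ENNReal.ofReal (‖x‖ ^ α) * G x) ∂(ν.prod ν) := by
        refine lintegral_mono fun p => ?_
        dsimp only
        rcases lt_or_ge ⟪(p.1 : E), p.2⟫ 0 with h | h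
        · simp [hB0 _ h]
        have hc := one_le_norm_add_of_inner_nonneg p h
        gcongr B _ * ?_
        refine le_trans (lintegral_mono fun x => ?_)
          (lintegral_comp_smul_le hc (fun x => ENNReal.ofReal (‖x‖ ^ α) * G x) (by fun_prop))
        dsimp only
        gcongr
        rw [norm_smul, norm_norm]
        exact le_mul_of_one_le_left (norm_nonneg _) hc
    _ = _ := by
        rw [lintegral_mul_const _ (by fun_prop), lintegral_prod _ (by fun_prop)]
        simp_rw [hM]
        rw [lintegral_const]
        ring

lemma lintegral_inner_sphere_eq (B : ℝ → ℝ≥0∞) (hB : Measurable B)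
    (ω ω' : Metric.sphere (0 : E) 1) :
    ∫⁻ σ : Metric.sphere (0 : E) 1, B ⟪(ω : E), σ⟫ ∂(volume : Measure E).toSphere =
      ∫⁻ σ : Metric.sphere (0 : E) 1, B ⟪(ω' : E), σ⟫ ∂(volume : Measure E).toSphere := by
  obtain ⟨u, hu⟩ := exists_unitary_apply_eq (x := (ω : E)) (y := ω') (by simp)
  rw [← (measurePreserving_sphereMap (Unitary.linearIsometryEquiv u)).lintegral_comp
    (f := fun σ => B ⟪(ω' : E), σ⟫) (by fun_prop)]
  refine lintegral_congr fun σ => ?_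
  change _ = B ⟪(ω' : E), (u : E →L[ℝ] E) σ⟫
  rw [← hu, Unitary.inner_map_map]

/-- Polar coordinates `v_* = v - r ω` for the pair `(v_*, σ)`. -/
lemma measurePreserving_collision [Nontrivial E] (v : E) :
    MeasurePreserving
      (fun q : (Metric.sphere (0 : E) 1 × Metric.sphere (0 : E) 1) × Set.Ioi (0 : ℝ) =>
        (v - (q.2 : ℝ) • (q.1.1 : E), q.1.2))
      (((volume : Measure E).toSphere.prod (volume : Measure E).toSphere).prod
          (.volumeIoiPow (Module.finrank ℝ E - 1)))
      (volume.prod (volume : Measure E).toSphere) := by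
  set ν := (volume : Measure E).toSphere
  set κ := Measure.volumeIoiPow (Module.finrank ℝ E - 1)
  have h1 := measurePreserving_prodAssoc ν ν κ
  have h2 := (MeasurePreserving.id ν).prod (Measure.measurePreserving_swap (μ := ν) (ν := κ))
  have h3 := (measurePreserving_prodAssoc ν κ ν).symm
  have h4 := ((Measure.measurePreserving_sub_left volume v).comp
    (measurePreserving_polar (E := E))).prod (MeasurePreserving.id ν)
  exact h4.comp (h3.comp (h2.comp h1))

omit [FiniteDimensional ℝ E] [MeasurableSpace E] [BorelSpace E] in
lemma abs_second_difference_le {f : E → ℝ} (hf : ContDiff ℝ 2 f) {W : ℝ}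
    (hW : ∀ x, ‖iteratedFDeriv ℝ 2 f x‖ ≤ W) (v y : E) :
    |f (v + y) + f (v - y) - 2 * f v| ≤ W * ‖y‖ ^ 2 := by
  have hd : Differentiable ℝ f := hf.differentiable (by norm_num)
  have hd' : Differentiable ℝ (fderiv ℝ f) :=
    (hf.fderiv_right (m := 1) (by norm_num)).differentiable (by norm_num)
  have hlip (x z : E) : ‖fderiv ℝ f x - fderiv ℝ f z‖ ≤ W * ‖x - z‖ := by
    refine Convex.norm_image_sub_le_of_norm_fderiv_le (𝕜 := ℝ) (fun x _ => hd' x) (fun x _ => ?_)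
      convex_univ (Set.mem_univ _) (Set.mem_univ _)
    rw [← norm_iteratedFDeriv_one, norm_iteratedFDeriv_fderiv]
    exact hW x
  have key := Convex.norm_image_sub_le_of_norm_hasFDerivWithin_le (𝕜 := ℝ)
    (f := fun x => f x - f (x - y)) (f' := fun x => fderiv ℝ f x - fderiv ℝ f (x - y))
    (C := W * ‖y‖) (s := Set.univ) (x := v) (y := v + y)
    (fun x _ => ((hd x).hasFDerivAt.sub
      ((hasFDerivAt_comp_sub y).2 (hd (x - y)).hasFDerivAt)).hasFDerivWithinAt)
    (fun x _ => by simpa using hlip x (x - y)) convex_univ (Set.mem_univ _) (Set.mem_univ _)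
  simp only [add_sub_cancel_right, add_sub_cancel_left, Real.norm_eq_abs] at key
  calc _ = |f (v + y) - f v - (f v - f (v - y))| := by ring_nf
    _ ≤ _ := key
    _ = _ := by ring

/-- The moment of order `α` of a translate of `g` is controlled by its weighted norm of order
`β ≥ α`. -/
lemma lintegral_weight_le (g : E → ℝ) (hg : Measurable g) {β : ℝ}
    (hI : Integrable fun w : E => (1 + ‖w‖ ^ 2) ^ (β / 2) * |g w|) {α : ℝ} (hα : 0 ≤ α)
    (hαβ : α ≤ β) (v : E) :
    ∫⁻ x : E, ENNReal.ofReal (‖x‖ ^ α) * ENNReal.ofReal |g (v - (2 : ℝ)⁻¹ • x)| ≤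
      ENNReal.ofReal (2 ^ Module.finrank ℝ E * 8 ^ (β / 2) * (1 + ‖v‖ ^ 2) ^ (β / 2) *
        ∫ w : E, (1 + ‖w‖ ^ 2) ^ (β / 2) * |g w|) := by
  have hpt (w : E) : ‖(2 : ℝ) • (v - w)‖ ^ α ≤
      8 ^ (β / 2) * (1 + ‖v‖ ^ 2) ^ (β / 2) * (1 + ‖w‖ ^ 2) ^ (β / 2) := by
    rw [← Real.mul_rpow (by positivity) (by positivity),
      ← Real.mul_rpow (by positivity) (by positivity)]
    have h1 : ‖(2 : ℝ) • (v - w)‖ ^ 2 ≤ 8 * (1 + ‖v‖ ^ 2) * (1 + ‖w‖ ^ 2) := by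
      have h := norm_sub_le v w
      have : ‖v - w‖ ^ 2 ≤ (‖v‖ + ‖w‖) ^ 2 := by gcongr
      rw [norm_smul, Real.norm_ofNat]
      nlinarith [sq_nonneg (‖v‖ - ‖w‖), mul_nonneg (sq_nonneg ‖v‖) (sq_nonneg ‖w‖)]
    have h2 : 1 ≤ 8 * (1 + ‖v‖ ^ 2) * (1 + ‖w‖ ^ 2) := by
      nlinarith [sq_nonneg ‖v‖, sq_nonneg ‖w‖, mul_nonneg (sq_nonneg ‖v‖) (sq_nonneg ‖w‖)]
    calc ‖(2 : ℝ) • (v - w)‖ ^ α = (‖(2 : ℝ) • (v - w)‖ ^ 2) ^ (α / 2) := by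
          rw [← Real.rpow_natCast_mul (norm_nonneg _)]
          congr 1
          push_cast
          ring
      _ ≤ (8 * (1 + ‖v‖ ^ 2) * (1 + ‖w‖ ^ 2)) ^ (α / 2) := by gcongr
      _ ≤ _ := Real.rpow_le_rpow_of_exponent_le h2 (by linarith)
  let K : E → ℝ≥0∞ := fun y => ENNReal.ofReal (‖(2 : ℝ) • y‖ ^ α) * ENNReal.ofReal |g (v - y)|
  have hK : Measurable K := by fun_prop
  calc _ = ∫⁻ x : E, K ((2 : ℝ)⁻¹ • x) := by
        refine lintegral_congr fun x => ?_
        simp [K, smul_smul]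
    _ = ENNReal.ofReal (2 ^ Module.finrank ℝ E) * ∫⁻ y, K y := by
        rw [← lintegral_map (f := K) (g := fun x => (2 : ℝ)⁻¹ • x) hK (by fun_prop),
          Measure.map_addHaar_smul _ (by norm_num), lintegral_smul_measure]
        simp
    _ = ENNReal.ofReal (2 ^ Module.finrank ℝ E) * ∫⁻ w, K (v - w) := by
        rw [lintegral_sub_left_eq_self]
    _ ≤ ENNReal.ofReal (2 ^ Module.finrank ℝ E) *
          ∫⁻ w, ENNReal.ofReal (8 ^ (β / 2) * (1 + ‖v‖ ^ 2) ^ (β / 2)) *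
            ENNReal.ofReal ((1 + ‖w‖ ^ 2) ^ (β / 2) * |g w|) := by
        gcongr with w
        simp only [K, sub_sub_cancel]
        rw [← ENNReal.ofReal_mul (by positivity), ← ENNReal.ofReal_mul (by positivity), ← mul_assoc]
        gcongr
        exact hpt w
    _ = _ := by
        rw [lintegral_const_mul' _ _ ENNReal.ofReal_ne_top,
          ← ofReal_integral_eq_lintegral_ofReal hI (ae_of_all _ fun w => by positivity),
          ← ENNReal.ofReal_mul (by positivity), ← ENNReal.ofReal_mul (by positivity)]
        congr 1
        ring

/-- The integrand of `Q¹` in the coordinates `v - v_* = r ω`. -/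
def polarIntegrand (γ : ℝ) (b : ℝ → ℝ) (g f : E → ℝ) (v : E)
    (q : (Metric.sphere (0 : E) 1 × Metric.sphere (0 : E) 1) × Set.Ioi (0 : ℝ)) : ℝ :=
  (q.2 : ℝ) ^ γ * b ⟪(q.1.1 : E), q.1.2⟫ *
    g (v - (2 : ℝ)⁻¹ • (q.2 : ℝ) • ((q.1.1 : E) + q.1.2)) *
    (f (v + ((2 : ℝ)⁻¹ * q.2) • ((q.1.2 : E) - q.1.1)) - f v)

lemma measurable_polarIntegrand {γ : ℝ} {b : ℝ → ℝ} (hb : Measurable b) {g : E → ℝ}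
    (hg : Measurable g) {f : E → ℝ} (hf : Measurable f) (v : E) :
    Measurable (polarIntegrand γ b g f v) := by
  unfold polarIntegrand
  fun_prop

lemma integrable_polarIntegrand [Nontrivial E] {γ : ℝ} (hγ : 0 ≤ γ) {b : ℝ → ℝ}
    (hb : Measurable b) (hb0 : ∀ s, 0 ≤ b s) (hbs : ∀ s < 0, b s = 0)
    (hbi : ∀ u : E, ‖u‖ = 1 → Integrable (fun σ : Metric.sphere (0 : E) 1 => b ⟪(σ : E), u⟫)
      (volume : Measure E).toSphere)
    {g : E → ℝ} (hg : Measurable g)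
    (hI : Integrable fun w : E => (1 + ‖w‖ ^ 2) ^ ((2 + γ) / 2) * |g w|)
    {f : E → ℝ} (hf : Measurable f) {W : ℝ} (hW : ∀ x, |f x| ≤ W) (v : E) :
    Integrable (polarIntegrand γ b g f v)
      (((volume : Measure E).toSphere.prod (volume : Measure E).toSphere).prod
          (.volumeIoiPow (Module.finrank ℝ E - 1))) := by
  refine ⟨(measurable_polarIntegrand hb hg hf v).aestronglyMeasurable, ?_⟩
  obtain ⟨e, he⟩ := exists_norm_eq E zero_le_one
  let ω₀ : Metric.sphere (0 : E) 1 := ⟨e, by simpa using he⟩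
  have hW0 : 0 ≤ W := (abs_nonneg _).trans (hW 0)
  have hM := lintegral_polar_add_le (fun s => ENNReal.ofReal (b s)) (by fun_prop)
    (fun s hs => by simp [hbs s hs]) _
    (fun ω => lintegral_inner_sphere_eq (fun s => ENNReal.ofReal (b s)) (by fun_prop) ω ω₀) hγ
    (fun x => ENNReal.ofReal (2 * W) * ENNReal.ofReal |g (v - (2 : ℝ)⁻¹ • x)|) (by fun_prop)
  refine lt_of_le_of_lt (le_trans (lintegral_mono fun q => ?_) hM) ?_
  · have hr : (0 : ℝ) < q.2 := q.2.2
    rw [polarIntegrand, Real.enorm_eq_ofReal_abs, ← ENNReal.ofReal_mul (by positivity),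
      ← ENNReal.ofReal_mul (by positivity),
      ← ENNReal.ofReal_mul (mul_nonneg (by positivity) (hb0 _)), abs_mul, abs_mul,
      abs_of_nonneg (mul_nonneg (by positivity) (hb0 _) : 0 ≤ (q.2 : ℝ) ^ γ * b _), mul_assoc,
      mul_comm |g _|]
    refine ENNReal.ofReal_le_ofReal ?_
    have h2 : |f (v + ((2 : ℝ)⁻¹ * q.2) • ((q.1.2 : E) - q.1.1)) - f v| ≤ 2 * W :=
      (abs_sub _ _).trans (by linarith [hW (v + ((2 : ℝ)⁻¹ * q.2) • ((q.1.2 : E) - q.1.1)), hW v])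
    have := hb0 ⟪(q.1.1 : E), q.1.2⟫
    gcongr
  · refine ENNReal.mul_lt_top ?_ ?_
    · simp_rw [real_inner_comm _ (ω₀ : E)]
      exact (hasFiniteIntegral_iff_ofReal (ae_of_all _ fun _ => hb0 _)).1 (hbi ω₀ he).2
    · simp_rw [mul_left_comm _ (ENNReal.ofReal (2 * W))]
      rw [lintegral_const_mul' _ _ ENNReal.ofReal_ne_top]
      exact ENNReal.mul_lt_top ENNReal.ofReal_lt_top
        ((lintegral_weight_le g hg hI hγ (by linarith) v).trans_lt ENNReal.ofReal_lt_top)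

omit [FiniteDimensional ℝ E] [MeasurableSpace E] [BorelSpace E] in
omit [FiniteDimensional ℝ E] [MeasurableSpace E] [BorelSpace E] in
/-- Exchanging `ω` and `σ` replaces `v' - v` by its opposite and keeps the other factors. -/
lemma abs_polarIntegrand_add_swap_le {γ : ℝ} {b : ℝ → ℝ} (hb0 : ∀ s, 0 ≤ b s) (g : E → ℝ)
    {f : E → ℝ} (hf : ContDiff ℝ 2 f) {W : ℝ} (hW : ∀ x, ‖iteratedFDeriv ℝ 2 f x‖ ≤ W) (v : E)
    (q : (Metric.sphere (0 : E) 1 × Metric.sphere (0 : E) 1) × Set.Ioi (0 : ℝ)) :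
    |polarIntegrand γ b g f v q + polarIntegrand γ b g f v (q.1.swap, q.2)| ≤
      (q.2 : ℝ) ^ (2 + γ) * (b ⟪(q.1.1 : E), q.1.2⟫ * (1 - ⟪(q.1.1 : E), q.1.2⟫)) *
        (W * |g (v - (2 : ℝ)⁻¹ • (q.2 : ℝ) • ((q.1.1 : E) + q.1.2))|) := by
  obtain ⟨⟨ω, σ⟩, r⟩ := q
  have hr : (0 : ℝ) < r := r.2
  have hW0 : 0 ≤ W := (norm_nonneg _).trans (hW 0)
  have hc : ⟪(ω : E), σ⟫ ≤ 1 := by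
    simpa using real_inner_le_norm (ω : E) (σ : E)
  set y : E := ((2 : ℝ)⁻¹ * r) • ((σ : E) - ω) with hy
  have hy' : ((2 : ℝ)⁻¹ * r) • ((ω : E) - σ) = -y := by
    rw [hy, ← smul_neg, neg_sub]
  have hyn : ‖y‖ ^ 2 = (r : ℝ) ^ 2 * (1 - ⟪(ω : E), σ⟫) / 2 := by
    rw [hy, norm_smul, mul_pow, norm_sub_sq_real, real_inner_comm]
    simp only [norm_eq_of_mem_sphere, Real.norm_eq_abs, sq_abs]
    ring
  have hsum : polarIntegrand γ b g f v ((ω, σ), r) + polarIntegrand γ b g f v ((σ, ω), r) =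
      (r : ℝ) ^ γ * b ⟪(ω : E), σ⟫ * g (v - (2 : ℝ)⁻¹ • (r : ℝ) • ((ω : E) + σ)) *
        (f (v + y) + f (v - y) - 2 * f v) := by
    simp only [polarIntegrand]
    rw [hy', ← sub_eq_add_neg, real_inner_comm (ω : E) σ, add_comm (σ : E) ω]
    ring
  have hfy := abs_second_difference_le hf hW v y
  simp only [Prod.swap_prod_mk]
  rw [hsum, abs_mul, abs_mul, abs_of_nonneg (mul_nonneg (by positivity) (hb0 _))]
  calc _ ≤ (r : ℝ) ^ γ * b ⟪(ω : E), σ⟫ * |g (v - (2 : ℝ)⁻¹ • (r : ℝ) • ((ω : E) + σ))| *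
        (W * ((r : ℝ) ^ 2 * (1 - ⟪(ω : E), σ⟫))) := by
        have := hb0 ⟪(ω : E), σ⟫
        have h1 : 0 ≤ (r : ℝ) ^ 2 * (1 - ⟪(ω : E), σ⟫) := mul_nonneg (by positivity) (by linarith)
        gcongr
        refine hfy.trans ?_
        gcongr
        rw [hyn]
        linarith
    _ = _ := by
        rw [Real.rpow_add hr, Real.rpow_ofNat]
        ring

lemma abs_integral_polarIntegrand_le [Nontrivial E] {γ : ℝ} (hγ : 0 ≤ γ) {b : ℝ → ℝ}
    (hb : Measurable b) (hb0 : ∀ s, 0 ≤ b s) (hbs : ∀ s < 0, b s = 0)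
    (hbi : ∀ u : E, ‖u‖ = 1 → Integrable (fun σ : Metric.sphere (0 : E) 1 => b ⟪(σ : E), u⟫)
      (volume : Measure E).toSphere)
    {m : ℝ} (hm : ∀ u : E, ‖u‖ = 1 → ∫ σ : Metric.sphere (0 : E) 1,
      b ⟪(σ : E), u⟫ * (1 - ⟪(σ : E), u⟫) ∂(volume : Measure E).toSphere = m)
    {g : E → ℝ} (hg : Measurable g)
    (hI : Integrable fun w : E => (1 + ‖w‖ ^ 2) ^ ((2 + γ) / 2) * |g w|)
    {f : E → ℝ} (hf : ContDiff ℝ 2 f) {W : ℝ} (hW0 : ∀ x, |f x| ≤ W)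
    (hW : ∀ x, ‖iteratedFDeriv ℝ 2 f x‖ ≤ W) (v : E) :
    |∫ q, polarIntegrand γ b g f v q
      ∂(((volume : Measure E).toSphere.prod (volume : Measure E).toSphere).prod
          (.volumeIoiPow (Module.finrank ℝ E - 1)))| ≤
      2 ^ Module.finrank ℝ E * 8 ^ ((2 + γ) / 2) * m *
        (∫ w : E, (1 + ‖w‖ ^ 2) ^ ((2 + γ) / 2) * |g w|) * W *
          (1 + ‖v‖ ^ 2) ^ ((2 + γ) / 2) := by
  set ν := (volume : Measure E).toSphere
  set P := (ν.prod ν).prod (Measure.volumeIoiPow (Module.finrank ℝ E - 1))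
  set H := polarIntegrand γ b g f v
  have hWn : 0 ≤ W := (abs_nonneg _).trans (hW0 0)
  have hIn : 0 ≤ ∫ w : E, (1 + ‖w‖ ^ 2) ^ ((2 + γ) / 2) * |g w| :=
    integral_nonneg fun w => by positivity
  have hinner (ω σ : Metric.sphere (0 : E) 1) : ⟪(ω : E), σ⟫ ≤ 1 := by
    simpa using real_inner_le_norm (ω : E) (σ : E)
  obtain ⟨e, he⟩ := exists_norm_eq E zero_le_one
  have hmn : 0 ≤ m := by
    rw [← hm e he]
    exact integral_nonneg fun σ => mul_nonneg (hb0 _)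
      (by have := hinner σ ⟨e, by simpa using he⟩; simpa using this)
  have hHi : Integrable H P :=
    integrable_polarIntegrand hγ hb hb0 hbs hbi hg hI hf.continuous.measurable hW0 v
  have hsw : MeasurePreserving (fun q : (Metric.sphere (0 : E) 1 × Metric.sphere (0 : E) 1) ×
      Set.Ioi (0 : ℝ) => (q.1.swap, q.2)) P P :=
    (Measure.measurePreserving_swap (μ := ν) (ν := ν)).prod (MeasurePreserving.id _)
  have hHi' : Integrable (fun q => H (q.1.swap, q.2)) P := hsw.integrable_comp_of_integrable hHi
  have hH' : ∫ q, H (q.1.swap, q.2) ∂P = ∫ q, H q ∂P := by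
    conv_rhs => rw [← hsw.map_eq]
    rw [integral_map hsw.measurable.aemeasurable]
    rw [hsw.map_eq]
    exact hHi.1
  have hsym : 2 * ∫ q, H q ∂P = ∫ q, (H q + H (q.1.swap, q.2)) ∂P := by
    rw [integral_add hHi hHi', hH', two_mul]
  have hmM (ω : Metric.sphere (0 : E) 1) : ∫⁻ σ : Metric.sphere (0 : E) 1,
      ENNReal.ofReal (b ⟪(ω : E), σ⟫ * (1 - ⟪(ω : E), σ⟫)) ∂ν = ENNReal.ofReal m := by
    have hω : ‖(ω : E)‖ = 1 := by simp
    rw [← hm ω hω]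
    simp_rw [real_inner_comm _ (ω : E)]
    rw [ofReal_integral_eq_lintegral_ofReal]
    · refine (hbi ω hω).mono' (Measurable.aestronglyMeasurable (by fun_prop))
        (ae_of_all _ fun σ => ?_)
      rw [Real.norm_eq_abs, abs_of_nonneg (mul_nonneg (hb0 _) (by linarith [hinner σ ω]))]
      rcases lt_or_ge ⟪(σ : E), ω⟫ 0 with h | h
      · simp [hbs _ h]
      · exact mul_le_of_le_one_right (hb0 _) (by linarith)
    · exact ae_of_all _ fun σ => mul_nonneg (hb0 _) (by linarith [hinner σ ω])
  have hM := lintegral_polar_add_le (fun s => ENNReal.ofReal (b s * (1 - s))) (by fun_prop)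
    (fun s hs => by simp [hbs s hs]) _ hmM (α := 2 + γ) (by linarith)
    (fun x => ENNReal.ofReal W * ENNReal.ofReal |g (v - (2 : ℝ)⁻¹ • x)|) (by fun_prop)
  have hle : |2 * ∫ q, H q ∂P| ≤ m * (W * (2 ^ Module.finrank ℝ E * 8 ^ ((2 + γ) / 2) *
      (1 + ‖v‖ ^ 2) ^ ((2 + γ) / 2) * ∫ w : E, (1 + ‖w‖ ^ 2) ^ ((2 + γ) / 2) * |g w|)) := by
    rw [hsym, ← ENNReal.ofReal_le_ofReal_iff (by positivity), ← Real.enorm_eq_ofReal_abs]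
    refine (enorm_integral_le_lintegral_enorm _).trans
      ((lintegral_mono fun q => ?_).trans (hM.trans ?_))
    · have hr : (0 : ℝ) < q.2 := q.2.2
      have h1 := mul_nonneg (hb0 ⟪(q.1.1 : E), q.1.2⟫)
        (sub_nonneg.2 (hinner q.1.1 q.1.2))
      rw [Real.enorm_eq_ofReal_abs, ← ENNReal.ofReal_mul (by positivity),
        ← ENNReal.ofReal_mul (by positivity), ← ENNReal.ofReal_mul (by positivity)]
      exact ENNReal.ofReal_le_ofReal (abs_polarIntegrand_add_swap_le hb0 g hf hW v q)
    · simp_rw [mul_left_comm _ (ENNReal.ofReal W)]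
      rw [lintegral_const_mul' _ _ ENNReal.ofReal_ne_top, ENNReal.ofReal_mul hmn, ENNReal.ofReal_mul hWn]
      gcongr
      exact lintegral_weight_le g hg hI (by linarith) le_rfl v
  rw [abs_mul, abs_two] at hle
  calc _ ≤ 2 * |∫ q, H q ∂P| := by linarith [abs_nonneg (∫ q, H q ∂P)]
    _ ≤ _ := hle
    _ = _ := by ring

end

/-- L∞ bound on the non-cutoff gain-type bilinear operator `Q¹` via the
`(1 - cos θ)`-moment (Lemma 4.2, case `2+γ ≥ 0` with `γ ≥ 0`).  The `W^{2,∞}` norm of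
`f` is expressed through a uniform bound `Wf` on all derivatives of order `≤ 2`. -/
theorem Q1_operator_bound_hard
    (d : ℕ) (hd : 2 ≤ d) (γ : ℝ) (hγ : γ ∈ Set.Icc (0 : ℝ) 1) :
    ∃ cst : ℝ, 0 < cst ∧
      ∀ b : ℝ → ℝ, Measurable b → (∀ s : ℝ, 0 ≤ b s) → (∀ s : ℝ, s < 0 → b s = 0) →
        (∀ u : Vd d, ‖u‖ = 1 →
          Integrable (fun σ : Metric.sphere (0 : Vd d) 1 => b ⟪(σ : Vd d), u⟫) (sphMeas d)) →
      ∀ mb : ℝ,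
        (∀ u : Vd d, ‖u‖ = 1 →
          (∫ σ : Metric.sphere (0 : Vd d) 1,
            b ⟪(σ : Vd d), u⟫ * (1 - ⟪(σ : Vd d), u⟫) ∂(sphMeas d)) = mb) →
      ∀ g : Vd d → ℝ, Measurable g →
        (Integrable fun w : Vd d => (1 + ‖w‖ ^ 2) ^ ((2 + γ) / 2) * |g w|) →
      ∀ f : Vd d → ℝ, ContDiff ℝ 2 f →
      ∀ Wf : ℝ,
        (∀ v : Vd d, ∀ k : ℕ, k ≤ 2 → ‖iteratedFDeriv ℝ k f v‖ ≤ Wf) →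
      ∀ v : Vd d,
        Integrable
          (fun p : Vd d × Metric.sphere (0 : Vd d) 1 =>
            ‖v - p.1‖ ^ γ * b (cosTheta d v p.1 p.2) * g (vPostStar d v p.1 p.2) *
              (f (vPost d v p.1 p.2) - f v))
          (volume.prod (sphMeas d)) ∧
        |∫ p : Vd d × Metric.sphere (0 : Vd d) 1,
            ‖v - p.1‖ ^ γ * b (cosTheta d v p.1 p.2) * g (vPostStar d v p.1 p.2) *
              (f (vPost d v p.1 p.2) - f v)
            ∂(volume.prod (sphMeas d))| ≤
          cst * mb * (∫ w : Vd d, (1 + ‖w‖ ^ 2) ^ ((2 + γ) / 2) * |g w|) * Wf *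
            (1 + ‖v‖ ^ 2) ^ ((2 + γ) / 2) := by
  have hpos : 0 < d := by omega
  have : Nonempty (Fin d) := ⟨⟨0, hpos⟩⟩
  refine ⟨2 ^ d * 8 ^ ((2 + γ) / 2), by positivity, ?_⟩
  intro b hb hb0 hbs hbi mb hmb g hg hI f hf Wf hWf v
  have hf0 (x : Vd d) : |f x| ≤ Wf := by simpa using hWf x 0 (by norm_num)
  have hf2 (x : Vd d) : ‖iteratedFDeriv ℝ 2 f x‖ ≤ Wf := hWf x 2 le_rfl
  have hΦ := measurePreserving_collision v
  have hfm : Measurable f := hf.continuous.measurable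
  have hmeas : Measurable fun p : Vd d × Metric.sphere (0 : Vd d) 1 =>
      ‖v - p.1‖ ^ γ * b (cosTheta d v p.1 p.2) * g (vPostStar d v p.1 p.2) *
        (f (vPost d v p.1 p.2) - f v) := by
    unfold cosTheta vPostStar vPost
    fun_prop
  have hpolar (q : (Metric.sphere (0 : Vd d) 1 × Metric.sphere (0 : Vd d) 1) × Set.Ioi (0 : ℝ)) :
      ‖v - (v - (q.2 : ℝ) • (q.1.1 : Vd d))‖ ^ γ *
        b (cosTheta d v (v - (q.2 : ℝ) • (q.1.1 : Vd d)) q.1.2) *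
        g (vPostStar d v (v - (q.2 : ℝ) • (q.1.1 : Vd d)) q.1.2) *
        (f (vPost d v (v - (q.2 : ℝ) • (q.1.1 : Vd d)) q.1.2) - f v) =
      polarIntegrand γ b g f v q := by
    have hr : (0 : ℝ) < q.2 := q.2.2
    have hn : ‖(q.2 : ℝ) • (q.1.1 : Vd d)‖ = q.2 := by simp [norm_smul, abs_of_pos hr]
    have h1 : vPostStar d v (v - (q.2 : ℝ) • (q.1.1 : Vd d)) q.1.2 =
        v - (2 : ℝ)⁻¹ • (q.2 : ℝ) • ((q.1.1 : Vd d) + q.1.2) := by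
      rw [vPostStar, sub_sub_cancel, hn]
      module
    have h2 : vPost d v (v - (q.2 : ℝ) • (q.1.1 : Vd d)) q.1.2 =
        v + ((2 : ℝ)⁻¹ * q.2) • ((q.1.2 : Vd d) - q.1.1) := by
      rw [vPost, sub_sub_cancel, hn]
      module
    have h3 : cosTheta d v (v - (q.2 : ℝ) • (q.1.1 : Vd d)) q.1.2 = ⟪(q.1.1 : Vd d), q.1.2⟫ := by
      rw [cosTheta, sub_sub_cancel, hn, inv_smul_smul₀ hr.ne']
    rw [h1, h2, h3, sub_sub_cancel, hn, polarIntegrand]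
  constructor
  · rw [sphMeas, ← hΦ.integrable_comp hmeas.aestronglyMeasurable]
    refine (integrable_polarIntegrand hγ.1 hb hb0 hbs hbi hg hI hfm hf0 v).congr
      (ae_of_all _ fun q => (hpolar q).symm)
  · rw [sphMeas, ← hΦ.map_eq,
      integral_map hΦ.measurable.aemeasurable hmeas.aestronglyMeasurable]
    simp_rw [hpolar]
    simpa using abs_integral_polarIntegrand_le hγ.1 hb hb0 hbs hbi hmb hg hI hf hf0 hf2 v

end
end

section
/- Lower bound for the twice-iterated gain operator (Lemma 3.8, after Pulvirenti–Wennberg). Let d ≥ 2 be an integer, γ ∈ (−d,1] and c_Φ > 0, let Φ : (0,∞) → [0,∞) satisfy Φ(z) ≥ c_Φ z^γ for all z > 0, and let b : [−1,1] → [0,∞) be measurable with l_b > 0. Let g : ℝ^d → [0,∞) be measurable with mass ρ_g = ∫_{ℝ^d} g(v) dv ∈ (0,∞), energy e_g = ∫_{ℝ^d} |v|² g(v) dv < ∞, and entropy h_g = ∫_{ℝ^d} g(v) |log g(v)| dv < ∞ (with the convention 0·log 0 = 0). Then there exist R₀ > 0, r₀ > 0, η₀ > 0 and v̄ ∈ B(0,R₀)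 such that Q⁺( Q⁺( g·1_{B(0,R₀)}, g·1_{B(0,R₀)} ), g·1_{B(0,R₀)} )(v) ≥ η₀ for every v ∈ ℝ^d with |v − v̄| < r₀. -/
open MeasureTheory Real
open scoped RealInnerProductSpace ENNReal

noncomputable section

/-- The Boltzmann gain operator
`Q⁺(g,h)(v) = ∫∫ Φ(|v-v_*|) b(cos θ) h(v') g(v'_*) dσ dv_*`,
as an `ℝ≥0∞`-valued integral of nonnegative integrands. -/
def QplusE (d : ℕ) (Φ b : ℝ → ℝ) (g h : Vd d → ℝ≥0∞) (v : Vd d) : ℝ≥0∞ :=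
  ∫⁻ vs : Vd d, ∫⁻ σ : Metric.sphere (0 : Vd d) 1,
    ENNReal.ofReal (Φ ‖v - vs‖) * ENNReal.ofReal (b (cosTheta d v vs σ)) *
      h (vPost d v vs σ) * g (vPostStar d v vs σ) ∂(sphMeas d)

/-- `l_b = inf_{π/4 ≤ θ ≤ 3π/4} b(cos θ)`. -/
def lbConst (b : ℝ → ℝ) : ℝ :=
  sInf ((fun θ : ℝ => b (Real.cos θ)) '' Set.Icc (π / 4) (3 * π / 4))

open Filter Topology

theorem tendsto_measure_symmDiff_sub_left {d : ℕ} {μ : Measure (Vd d)} [IsFiniteMeasure μ]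
    (hμ : μ ≪ volume) {A : Set (Vd d)} (hA : MeasurableSet A) (hA' : volume A ≠ ∞) (v₀ : Vd d) :
    Tendsto (fun v => μ (symmDiff ((fun x => v - x) ⁻¹' A) ((fun x => v₀ - x) ⁻¹' A)))
      (𝓝 v₀) (𝓝 0) := by
  let f : Vd d → C(Vd d, Vd d) := fun v => ⟨fun x => v - x, by fun_prop⟩
  have hf : Continuous f := ContinuousMap.continuous_of_continuous_uncurry _ <| by
    change Continuous fun p : Vd d × Vd d => p.1 - p.2
    fun_prop
  have hvol : Tendsto (fun v => volume (symmDiff (f v ⁻¹' A) (f v₀ ⁻¹' A))) (𝓝 v₀) (𝓝 0) :=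
    tendsto_measure_symmDiff_preimage_nhds_zero hf.continuousAt
      (.of_forall fun v => Measure.measurePreserving_sub_left volume v)
      (Measure.measurePreserving_sub_left volume v₀) hA.nullMeasurableSet hA'
  have key := tendsto_setLIntegral_zero (μ := (volume : Measure (Vd d)))
    (f := μ.rnDeriv volume) (Measure.lintegral_rnDeriv_lt_top μ volume).ne hvol
  refine key.congr fun v => ?_
  have hm : MeasurableSet (symmDiff (f v ⁻¹' A) (f v₀ ⁻¹' A)) :=
    ((f v).continuous.measurable hA).symmDiff ((f v₀).continuous.measurable hA)
  rw [← withDensity_apply _ hm, Measure.withDensity_rnDeriv_eq _ _ hμ]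
  rfl

/-- For a fixed unit vector `u`, the map `w ↦ (w - |w|u)/2` pulls null sets back to null sets,
away from the half-line on which `u` is parallel to `w`. -/
theorem volume_preimage_half_sub_norm_smul {d : ℕ} {u : Vd d} (hu : ‖u‖ = 1) {N : Set (Vd d)}
    (hN : volume N = 0) :
    volume {w : Vd d | ⟪w, u⟫ < ‖w‖ ∧ (2 : ℝ)⁻¹ • (w - ‖w‖ • u) ∈ N} = 0 := by
  let S : Vd d → Vd d := fun x => (2 : ℝ) • x - (‖x‖ ^ 2 / ⟪x, u⟫) • u
  have hS : DifferentiableOn ℝ S (N ∩ {x | ⟪x, u⟫ ≠ 0}) := by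
    intro x hx
    have hx' : ⟪x, u⟫ ≠ 0 := hx.2
    have h1 : DifferentiableAt ℝ (fun x : Vd d => ‖x‖ ^ 2) x :=
      (contDiff_norm_sq ℝ).differentiable (n := 1) (by simp) x
    have h2 : DifferentiableAt ℝ (fun x : Vd d => ⟪x, u⟫) x :=
      differentiableAt_id.inner ℝ (differentiableAt_const u)
    have h3 : DifferentiableAt ℝ (fun x : Vd d => ‖x‖ ^ 2 / ⟪x, u⟫) x :=
      h1.fun_mul (h2.fun_inv hx')
    exact ((differentiableAt_id.const_smul (2 : ℝ)).sub
      (h3.smul_const u)).differentiableWithinAt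
  refine measure_mono_null ?_ (addHaar_image_eq_zero_of_differentiableOn_of_addHaar_eq_zero
    volume hS (measure_mono_null Set.inter_subset_left hN))
  rintro w ⟨hw, hwN⟩
  have huu : ⟪u, u⟫ = 1 := by rw [real_inner_self_eq_norm_sq, hu]; norm_num
  have hin : ⟪(2 : ℝ)⁻¹ • (w - ‖w‖ • u), u⟫ = 2⁻¹ * (⟪w, u⟫ - ‖w‖) := by
    rw [real_inner_smul_left, inner_sub_left, real_inner_smul_left, huu, mul_one]
  have hne : ⟪w, u⟫ - ‖w‖ ≠ 0 := by linarith
  have hsq : ‖(2 : ℝ)⁻¹ • (w - ‖w‖ • u)‖ ^ 2 = -‖w‖ * (2⁻¹ * (⟪w, u⟫ - ‖w‖)) := by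
    rw [norm_smul, mul_pow, norm_sub_sq_real, norm_smul, real_inner_smul_right, hu]
    simp only [norm_inv, norm_norm, Real.norm_ofNat]
    ring
  refine ⟨_, ⟨hwN, ?_⟩, ?_⟩
  · change _ ≠ _
    rw [hin]
    exact mul_ne_zero (by norm_num) hne
  · simp only [S]
    rw [hin, hsq, mul_div_cancel_right₀ _ (mul_ne_zero (by norm_num) hne), smul_smul]
    norm_num

/-- Pairs (relative velocity, scattering direction) with relative speed in `(δ, M)` and
deviation angle in `(π/4, 3π/4)`. -/
def collisionDomain (d : ℕ) (δ M : ℝ) : Set (Vd d × Metric.sphere (0 : Vd d) 1) :=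
  {p | δ < ‖p.1‖ ∧ ‖p.1‖ < M ∧ |⟪p.1, (p.2 : Vd d)⟫| < √2 / 2 * ‖p.1‖}

/-- The product measure restricted to `collisionDomain`. -/
def collisionMeasure (d : ℕ) (δ M : ℝ) : Measure (Vd d × Metric.sphere (0 : Vd d) 1) :=
  (volume.prod (sphMeas d)).restrict (collisionDomain d δ M)

instance (d : ℕ) : IsFiniteMeasure (sphMeas d) := by
  unfold sphMeas; infer_instance

instance (d : ℕ) : (sphMeas d).IsOpenPosMeasure := by
  unfold sphMeas; infer_instance

theorem isOpen_collisionDomain (d : ℕ) (δ M : ℝ) : IsOpen (collisionDomain d δ M) := by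
  have h1 : Continuous fun p : Vd d × Metric.sphere (0 : Vd d) 1 => ‖p.1‖ := by fun_prop
  have h2 : Continuous fun p : Vd d × Metric.sphere (0 : Vd d) 1 => |⟪p.1, (p.2 : Vd d)⟫| :=
    (continuous_fst.inner (continuous_subtype_val.comp continuous_snd)).abs
  exact (isOpen_lt continuous_const h1).inter
    ((isOpen_lt h1 continuous_const).inter (isOpen_lt h2 (continuous_const.mul h1)))

instance (d : ℕ) (δ M : ℝ) : IsFiniteMeasure (collisionMeasure d δ M) := by
  refine ⟨?_⟩
  rw [collisionMeasure, Measure.restrict_apply_univ]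
  refine (measure_mono (t := Metric.ball 0 M ×ˢ Set.univ) fun p hp => ?_).trans_lt ?_
  · simpa using hp.2.1
  · rw [Measure.prod_prod]
    exact ENNReal.mul_lt_top measure_ball_lt_top (measure_lt_top _ _)

/-- The displacement `v - v'` (for `s = -1`) or `v - v'_*` (for `s = 1`), as a function of
`v - v_*` and `σ`. -/
def collisionShift (d : ℕ) (s : ℝ) (p : Vd d × Metric.sphere (0 : Vd d) 1) : Vd d :=
  (2 : ℝ)⁻¹ • (p.1 + (s * ‖p.1‖) • (p.2 : Vd d))

theorem continuous_collisionShift (d : ℕ) (s : ℝ) : Continuous (collisionShift d s) := by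
  unfold collisionShift; fun_prop

theorem map_collisionShift_absolutelyContinuous (d : ℕ) {δ : ℝ} (hδ : 0 ≤ δ) (M : ℝ) {s : ℝ}
    (hs : |s| = 1) : (collisionMeasure d δ M).map (collisionShift d s) ≪ volume := by
  refine Measure.AbsolutelyContinuous.mk fun N hNm hN => ?_
  have hc := continuous_collisionShift d s
  have hm := hc.measurable hNm
  rw [Measure.map_apply hc.measurable hNm, collisionMeasure, Measure.restrict_apply hm,
    Measure.prod_apply_symm (hm.inter (isOpen_collisionDomain d δ M).measurableSet)]
  refine (lintegral_congr fun σ => ?_).trans lintegral_zero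
  have hσ : ‖(σ : Vd d)‖ = 1 := by simp
  have hu : ‖-(s • (σ : Vd d))‖ = 1 := by rw [norm_neg, norm_smul, hσ, Real.norm_eq_abs, hs, one_mul]
  refine measure_mono_null ?_ (volume_preimage_half_sub_norm_smul hu hN)
  rintro w ⟨hwN, hδw, -, hcos⟩
  have hw0 : 0 < ‖w‖ := hδ.trans_lt hδw
  have h2 : √2 / 2 < 1 := by
    have : √2 < 2 := by rw [Real.sqrt_lt' (by norm_num)]; norm_num
    linarith
  refine ⟨?_, ?_⟩
  · rw [inner_neg_right, real_inner_smul_right]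
    calc -(s * ⟪w, (σ : Vd d)⟫) ≤ |s * ⟪w, (σ : Vd d)⟫| := neg_le_abs _
      _ = |⟪w, (σ : Vd d)⟫| := by rw [abs_mul, hs, one_mul]
      _ < √2 / 2 * ‖w‖ := hcos
      _ < ‖w‖ := by nlinarith
  · have : (2 : ℝ)⁻¹ • (w - ‖w‖ • -(s • (σ : Vd d))) = collisionShift d s (w, σ) := by
      simp only [collisionShift, smul_neg, sub_neg_eq_add, smul_smul, mul_comm]
    rw [this]
    exact hwN

/-- The collisions whose post-collisional velocities lie in `A` and `B`. -/
def collisionsInto (d : ℕ) (A B : Set (Vd d)) (v : Vd d) :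
    Set (Vd d × Metric.sphere (0 : Vd d) 1) :=
  {p | v - collisionShift d (-1) p ∈ A ∧ v - collisionShift d 1 p ∈ B}

theorem measurableSet_collisionsInto {d : ℕ} {A B : Set (Vd d)} (hA : MeasurableSet A)
    (hB : MeasurableSet B) (v : Vd d) : MeasurableSet (collisionsInto d A B v) := by
  have h (s : ℝ) : Measurable fun p => v - collisionShift d s p :=
    (continuous_const.sub (continuous_collisionShift d s)).measurable
  exact (h (-1) hA).inter (h 1 hB)

theorem eventually_le_collisionMeasure {d : ℕ} {δ : ℝ} (hδ : 0 ≤ δ) (M : ℝ) {A B : Set (Vd d)}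
    (hA : MeasurableSet A) (hA' : volume A ≠ ∞) (hB : MeasurableSet B) (hB' : volume B ≠ ∞)
    {v₀ : Vd d} (h : collisionMeasure d δ M (collisionsInto d A B v₀) ≠ 0) :
    ∀ᶠ v in 𝓝 v₀, collisionMeasure d δ M (collisionsInto d A B v₀) / 2 ≤
      collisionMeasure d δ M (collisionsInto d A B v) := by
  set ν := collisionMeasure d δ M
  set m := ν (collisionsInto d A B v₀)
  have hm : m ≠ ∞ := measure_ne_top _ _
  have hT (s : ℝ) : Measurable (collisionShift d s) := (continuous_collisionShift d s).measurable
  have htend (s : ℝ) (hs : |s| = 1) {C : Set (Vd d)} (hC : MeasurableSet C) (hC' : volume C ≠ ∞) :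
      ∀ᶠ v in 𝓝 v₀, ν (collisionShift d s ⁻¹'
        (symmDiff ((fun x => v - x) ⁻¹' C) ((fun x => v₀ - x) ⁻¹' C))) < m / 4 := by
    have := tendsto_measure_symmDiff_sub_left
      (map_collisionShift_absolutelyContinuous d hδ M hs) hC hC' v₀
    filter_upwards [this.eventually_lt_const
      (ENNReal.div_pos h (by norm_num : (4 : ℝ≥0∞) ≠ ∞))] with v hv
    rwa [Measure.map_apply (hT s)] at hv
    exact ((measurable_const_sub v) hC).symmDiff ((measurable_const_sub v₀) hC)
  filter_upwards [htend (-1) (by simp) hA hA', htend 1 (by simp) hB hB'] with v hvA hvB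
  have hsub : collisionsInto d A B v₀ ⊆ collisionsInto d A B v ∪
      (collisionShift d (-1) ⁻¹'
        (symmDiff ((fun x => v - x) ⁻¹' A) ((fun x => v₀ - x) ⁻¹' A)) ∪
      collisionShift d 1 ⁻¹'
        (symmDiff ((fun x => v - x) ⁻¹' B) ((fun x => v₀ - x) ⁻¹' B))) := by
    rintro p ⟨hpA, hpB⟩
    by_cases h1 : v - collisionShift d (-1) p ∈ A
    · by_cases h2 : v - collisionShift d 1 p ∈ B
      · exact Or.inl ⟨h1, h2⟩
      · exact Or.inr (Or.inr (Or.inr ⟨hpB, h2⟩))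
    · exact Or.inr (Or.inl (Or.inr ⟨hpA, h1⟩))
  have hle : m ≤ ν (collisionsInto d A B v) + (m / 4 + m / 4) :=
    (measure_mono hsub).trans <| (measure_union_le _ _).trans <| by
      gcongr
      exact (measure_union_le _ _).trans (add_le_add hvA.le hvB.le)
  have h4 : m / 4 + m / 4 = m / 2 := by
    rw [← two_mul, div_eq_mul_inv, div_eq_mul_inv, mul_left_comm]
    congr 1
    rw [show (4 : ℝ≥0∞) = 2 * 2 by norm_num, ENNReal.mul_inv (by simp) (by simp), ← mul_assoc,
      ENNReal.mul_inv_cancel (by simp) (by simp), one_mul]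
  rw [h4] at hle
  rw [← ENNReal.sub_half hm]
  exact tsub_le_iff_right.2 hle

/-- Two sets of positive volume have translates that overlap in positive volume, for every
translation vector in some nonempty open set. -/
theorem exists_isOpen_volume_inter_translate_ne_zero {d : ℕ} (hd : d ≠ 0) {A B : Set (Vd d)}
    (hA : MeasurableSet A) (hA0 : volume A ≠ 0) (hA' : volume A ≠ ∞)
    (hB : MeasurableSet B) (hB0 : volume B ≠ 0) (hB' : volume B ≠ ∞) :
    ∃ z₀ : Vd d, z₀ ≠ 0 ∧ ∀ᶠ z in 𝓝 z₀, volume {x | x ∈ A ∧ x - z ∈ B} ≠ 0 := by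
  have : Nonempty (Fin d) := ⟨⟨0, Nat.pos_of_ne_zero hd⟩⟩
  have hex : ∃ z₀ : Vd d, z₀ ≠ 0 ∧ volume {x | x ∈ A ∧ x - z₀ ∈ B} ≠ 0 := by
    by_contra! hcon
    have hE : MeasurableSet {q : Vd d × Vd d | q.2 ∈ A ∧ q.2 - q.1 ∈ B} :=
      (measurable_snd hA).inter ((measurable_snd.sub measurable_fst) hB)
    have h0 : (volume.prod volume) {q : Vd d × Vd d | q.2 ∈ A ∧ q.2 - q.1 ∈ B} = 0 := by
      rw [Measure.measure_prod_null hE]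
      filter_upwards [Measure.ae_ne volume (0 : Vd d)] with z hz using hcon z hz
    rw [Measure.prod_apply_symm hE] at h0
    have h1 : ∀ x : Vd d, volume ((fun z => (z, x)) ⁻¹' {q : Vd d × Vd d | q.2 ∈ A ∧ q.2 - q.1 ∈ B})
        = A.indicator (fun _ => volume B) x := by
      intro x
      by_cases hx : x ∈ A
      · rw [Set.indicator_of_mem hx,
          ← (Measure.measurePreserving_sub_left volume x).measure_preimage hB.nullMeasurableSet]
        congr 1
        ext z
        simp [hx]
      · simp [hx]
    simp_rw [h1] at h0
    rw [lintegral_indicator_const hA] at h0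
    exact (mul_ne_zero hB0 hA0) h0
  obtain ⟨z₀, hz₀, hpos⟩ := hex
  refine ⟨z₀, hz₀, ?_⟩
  have hnegB : MeasurableSet (-B) := hB.neg
  have hnegB' : volume (-B) ≠ ∞ := by rwa [Measure.measure_neg]
  have : IsFiniteMeasure (volume.restrict A) := ⟨by
    rw [Measure.restrict_apply_univ]; exact hA'.lt_top⟩
  have ht := tendsto_measure_symmDiff_sub_left (μ := volume.restrict A)
    Measure.absolutelyContinuous_restrict hnegB hnegB' z₀
  filter_upwards [ht.eventually_lt_const (pos_iff_ne_zero.2 hpos)] with z hz h0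
  refine hz.not_ge ?_
  rw [Measure.restrict_apply (((measurable_const_sub z) hnegB).symmDiff
    ((measurable_const_sub z₀) hnegB))]
  have hsub : {x | x ∈ A ∧ x - z₀ ∈ B} ⊆ {x | x ∈ A ∧ x - z ∈ B} ∪
      symmDiff ((fun x => z - x) ⁻¹' (-B)) ((fun x => z₀ - x) ⁻¹' (-B)) ∩ A := by
    rintro x ⟨hxA, hxB⟩
    by_cases h : x - z ∈ B
    · exact Or.inl ⟨hxA, h⟩
    · refine Or.inr ⟨Or.inr ⟨?_, ?_⟩, hxA⟩ <;> simpa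
  refine (measure_mono hsub).trans ((measure_union_le _ _).trans ?_)
  rw [h0, zero_add]

theorem exists_inner_eq_zero_norm_eq {d : ℕ} (hd : 2 ≤ d) (z : Vd d) :
    ∃ w : Vd d, ⟪w, z⟫ = 0 ∧ ‖w‖ = ‖z‖ := by
  have h1 := Submodule.finrank_add_finrank_orthogonal (ℝ ∙ z)
  rw [finrank_euclideanSpace_fin] at h1
  have h2 : Module.finrank ℝ (ℝ ∙ z) ≤ 1 := by
    simpa using finrank_span_le_card (R := ℝ) ({z} : Set (Vd d))
  have : Nontrivial (ℝ ∙ z)ᗮ := Module.finrank_pos_iff (R := ℝ).1 (by omega)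
  obtain ⟨w, hw⟩ := exists_norm_eq (ℝ ∙ z)ᗮ (norm_nonneg z)
  refine ⟨w, ?_, by simpa using hw⟩
  exact Submodule.inner_left_of_mem_orthogonal (Submodule.mem_span_singleton_self z) w.2

theorem exists_collisionMeasure_collisionsInto_ne_zero {d : ℕ} (hd : 2 ≤ d) {A B : Set (Vd d)}
    (hA : MeasurableSet A) (hA0 : volume A ≠ 0) (hA' : volume A ≠ ∞)
    (hB : MeasurableSet B) (hB0 : volume B ≠ 0) (hB' : volume B ≠ ∞) :
    ∃ δ M : ℝ, 0 < δ ∧ 0 < M ∧ ∃ v₀ : Vd d, collisionMeasure d δ M (collisionsInto d A B v₀) ≠ 0 := by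
  obtain ⟨z₀, hz₀, hev⟩ :=
    exists_isOpen_volume_inter_translate_ne_zero (by omega) hA hA0 hA' hB hB0 hB'
  have hz : 0 < ‖z₀‖ := norm_pos_iff.2 hz₀
  refine ⟨‖z₀‖ / 2, 2 * ‖z₀‖, by positivity, by positivity, ?_⟩
  by_contra! hcon
  set ν := collisionMeasure d (‖z₀‖ / 2) (2 * ‖z₀‖) with hν
  have hE : MeasurableSet {q : Vd d × (Vd d × Metric.sphere (0 : Vd d) 1) |
      q.1 - collisionShift d (-1) q.2 ∈ A ∧ q.1 - collisionShift d 1 q.2 ∈ B} := by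
    have h (s : ℝ) : Measurable fun q : Vd d × (Vd d × Metric.sphere (0 : Vd d) 1) =>
        q.1 - collisionShift d s q.2 :=
      (continuous_fst.sub ((continuous_collisionShift d s).comp continuous_snd)).measurable
    exact (h (-1) hA).inter (h 1 hB)
  have h0 := (Measure.measure_prod_null (μ := volume) (ν := ν) hE).2
    (Eventually.of_forall fun v => hcon v)
  rw [Measure.prod_apply_symm hE, lintegral_eq_zero_iff (measurable_measure_prodMk_right hE)] at h0
  have h1 : ∀ᵐ p ∂ν, volume {x | x ∈ A ∧ x - ‖p.1‖ • (p.2 : Vd d) ∈ B} = 0 := by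
    filter_upwards [h0] with p hp
    refine Eq.trans ?_ hp
    change volume (A ∩ (fun x => x - ‖p.1‖ • (p.2 : Vd d)) ⁻¹' B) = _
    rw [← (measurePreserving_sub_right volume (collisionShift d (-1) p)).measure_preimage
      (hA.inter ((measurable_sub_const _) hB)).nullMeasurableSet]
    congr 1
    ext v
    have : v - collisionShift d (-1) p - ‖p.1‖ • (p.2 : Vd d) = v - collisionShift d 1 p := by
      simp only [collisionShift]
      module
    simp [this]
  obtain ⟨w₀, hw₀, hw₀'⟩ := exists_inner_eq_zero_norm_eq hd z₀
  let σ₀ : Metric.sphere (0 : Vd d) 1 := ⟨‖z₀‖⁻¹ • z₀, by simp [norm_smul, hz.ne']⟩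
  have hmem : (w₀, σ₀) ∈ collisionDomain d (‖z₀‖ / 2) (2 * ‖z₀‖) := by
    refine ⟨?_, ?_, ?_⟩
    · simp only [hw₀']; linarith
    · simp only [hw₀']; linarith
    · simp only [σ₀, real_inner_smul_right, hw₀, hw₀']
      simp only [mul_zero, abs_zero]
      positivity
  have hcont : Continuous fun p : Vd d × Metric.sphere (0 : Vd d) 1 => ‖p.1‖ • (p.2 : Vd d) := by
    fun_prop
  have hval : ‖w₀‖ • (σ₀ : Vd d) = z₀ := by
    simp only [σ₀, hw₀', smul_smul, mul_inv_cancel₀ hz.ne', one_smul]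
  have hnhds : ∀ᶠ p in 𝓝 (w₀, σ₀), p ∈ collisionDomain d (‖z₀‖ / 2) (2 * ‖z₀‖) ∧
      volume {x | x ∈ A ∧ x - ‖p.1‖ • (p.2 : Vd d) ∈ B} ≠ 0 := by
    refine ((isOpen_collisionDomain d _ _).eventually_mem hmem).and ?_
    have ht := hcont.tendsto (w₀, σ₀)
    simp only [hval] at ht
    exact ht.eventually hev
  rw [hν, collisionMeasure, ae_restrict_iff' (isOpen_collisionDomain d _ _).measurableSet] at h1
  refine (Measure.measure_pos_of_mem_nhds (volume.prod (sphMeas d)) hnhds).ne' ?_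
  refine measure_mono_null ?_ h1
  rintro p ⟨hp, hp'⟩ h
  exact hp' (h hp)

theorem lbConst_le {b : ℝ → ℝ} (hb : ∀ s, 0 ≤ b s) {c : ℝ} (hc : |c| ≤ √2 / 2) :
    lbConst b ≤ b c := by
  have h2 : √2 / 2 ≤ 1 := by
    have : √2 ≤ 2 := by rw [Real.sqrt_le_left (by norm_num)]; norm_num
    linarith
  obtain ⟨hc1, hc2⟩ := abs_le.1 hc
  refine csInf_le ⟨0, ?_⟩ ⟨Real.arccos c, ⟨?_, ?_⟩, ?_⟩
  · rintro _ ⟨θ, -, rfl⟩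
    exact hb _
  · rw [← Real.arccos_cos (x := π / 4) (by positivity) (by linarith [Real.pi_pos]), Real.cos_pi_div_four]
    exact Real.arccos_le_arccos hc2
  · have h3 : Real.cos (3 * π / 4) = -(√2 / 2) := by
      rw [show 3 * π / 4 = π - π / 4 by ring, Real.cos_pi_sub, Real.cos_pi_div_four]
    rw [← Real.arccos_cos (x := 3 * π / 4) (by positivity) (by linarith [Real.pi_pos]), h3]
    exact Real.arccos_le_arccos hc1
  · simp only
    rw [Real.cos_arccos (by linarith) (by linarith)]

theorem min_rpow_le {δ M z γ : ℝ} (hδ : 0 < δ) (h1 : δ ≤ z) (h2 : z ≤ M) :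
    min (δ ^ γ) (M ^ γ) ≤ z ^ γ := by
  rcases le_total 0 γ with h | h
  · exact (min_le_left _ _).trans (Real.rpow_le_rpow hδ.le h1 h)
  · exact (min_le_right _ _).trans (Real.rpow_le_rpow_of_nonpos (hδ.trans_le h1) h2 h)

theorem mul_collisionMeasure_le_QplusE {d : ℕ} {γ cΦ : ℝ} (hcΦ : 0 ≤ cΦ) {Φ : ℝ → ℝ}
    (hΦ : ∀ z : ℝ, 0 < z → cΦ * z ^ γ ≤ Φ z) {b : ℝ → ℝ} (hb0 : ∀ s : ℝ, 0 ≤ b s)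
    {δ M : ℝ} (hδ : 0 < δ) {A B : Set (Vd d)} (hA : MeasurableSet A) (hB : MeasurableSet B)
    {g h : Vd d → ℝ≥0∞} {cg ch : ℝ≥0∞} (hg : ∀ x ∈ B, cg ≤ g x) (hh : ∀ x ∈ A, ch ≤ h x)
    (v : Vd d) :
    ENNReal.ofReal (cΦ * min (δ ^ γ) (M ^ γ)) * ENNReal.ofReal (lbConst b) * ch * cg *
      collisionMeasure d δ M (collisionsInto d A B v) ≤ QplusE d Φ b g h v := by
  set K := ENNReal.ofReal (cΦ * min (δ ^ γ) (M ^ γ)) * ENNReal.ofReal (lbConst b) * ch * cg with hK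
  have hm := measurableSet_collisionsInto hA hB v
  have hmG := hm.inter (isOpen_collisionDomain d δ M).measurableSet
  rw [collisionMeasure, Measure.restrict_apply hm, Measure.prod_apply hmG,
    ← lintegral_const_mul _ (measurable_measure_prodMk_left hmG), QplusE,
    ← lintegral_sub_left_eq_self (fun vs => ∫⁻ σ, _ ∂(sphMeas d)) v]
  refine lintegral_mono fun w => ?_
  rw [← lintegral_indicator_const (measurable_prodMk_left hmG)]
  refine lintegral_mono fun σ => ?_
  by_cases hσ : σ ∈ Prod.mk w ⁻¹' (collisionsInto d A B v ∩ collisionDomain d δ M)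
  swap
  · rw [Set.indicator_of_notMem hσ]
    exact zero_le
  rw [Set.indicator_of_mem hσ]
  obtain ⟨⟨hσA, hσB⟩, hw1, hw2, hcos⟩ := hσ
  simp only at hw1 hw2 hcos
  have hw0 : 0 < ‖w‖ := hδ.trans hw1
  have e1 : vPost d v (v - w) σ = v - collisionShift d (-1) (w, σ) := by
    simp only [vPost, collisionShift, sub_sub_cancel]
    module
  have e2 : vPostStar d v (v - w) σ = v - collisionShift d 1 (w, σ) := by
    simp only [vPostStar, collisionShift, sub_sub_cancel]
    module
  rw [hK, e1, e2, sub_sub_cancel]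
  gcongr
  · exact (mul_le_mul_of_nonneg_left (min_rpow_le hδ hw1.le hw2.le) hcΦ).trans (hΦ _ hw0)
  · refine lbConst_le hb0 ?_
    rw [cosTheta, sub_sub_cancel, real_inner_smul_left, abs_mul, abs_of_pos (inv_pos.2 hw0),
      inv_mul_le_iff₀ hw0, mul_comm]
    exact hcos.le
  · exact hh _ hσA
  · exact hg _ hσB

/-- The gain operator spreads positivity: if `g` and `h` are bounded below on sets of positive
measure then `Q⁺(g, h)` is bounded below on a ball. -/
theorem exists_ball_le_QplusE {d : ℕ} (hd : 2 ≤ d) {γ cΦ : ℝ} (hcΦ : 0 < cΦ) {Φ : ℝ → ℝ}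
    (hΦ : ∀ z : ℝ, 0 < z → cΦ * z ^ γ ≤ Φ z) {b : ℝ → ℝ} (hb0 : ∀ s : ℝ, 0 ≤ b s)
    (hlb : 0 < lbConst b) {A B : Set (Vd d)}
    (hA : MeasurableSet A) (hA0 : volume A ≠ 0) (hA' : volume A ≠ ∞)
    (hB : MeasurableSet B) (hB0 : volume B ≠ 0) (hB' : volume B ≠ ∞)
    {cg ch : ℝ} (hcg : 0 < cg) (hch : 0 < ch) :
    ∃ v₀ : Vd d, ∃ r : ℝ, 0 < r ∧ ∃ η : ℝ, 0 < η ∧ ∀ g h : Vd d → ℝ≥0∞,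
      (∀ x ∈ B, ENNReal.ofReal cg ≤ g x) → (∀ x ∈ A, ENNReal.ofReal ch ≤ h x) →
      ∀ v ∈ Metric.ball v₀ r, ENNReal.ofReal η ≤ QplusE d Φ b g h v := by
  obtain ⟨δ, M, hδ, hM, v₀, hv₀⟩ :=
    exists_collisionMeasure_collisionsInto_ne_zero hd hA hA0 hA' hB hB0 hB'
  obtain ⟨r, hr, hball⟩ := Metric.eventually_nhds_iff_ball.1
    (eventually_le_collisionMeasure hδ.le M hA hA' hB hB' hv₀)
  set m := collisionMeasure d δ M (collisionsInto d A B v₀)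
  have hm : m ≠ ∞ := measure_ne_top _ _
  set k := cΦ * min (δ ^ γ) (M ^ γ) with hk
  have hk0 : 0 < k := mul_pos hcΦ (lt_min (Real.rpow_pos_of_pos hδ _) (Real.rpow_pos_of_pos hM _))
  have hm0 : 0 < m.toReal := ENNReal.toReal_pos hv₀ hm
  refine ⟨v₀, r, hr, k * lbConst b * ch * cg * (m.toReal / 2), by positivity,
    fun g h hg hh v hv => le_trans ?_
      (mul_collisionMeasure_le_QplusE hcΦ.le hΦ hb0 (M := M) hδ hA hB hg hh v)⟩
  rw [ENNReal.ofReal_mul (by positivity), ENNReal.ofReal_mul (by positivity),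
    ENNReal.ofReal_mul (by positivity), ENNReal.ofReal_mul (by positivity),
    ENNReal.ofReal_div_of_pos two_pos, ENNReal.ofReal_toReal hm, ENNReal.ofReal_ofNat]
  gcongr
  exact hball v hv

theorem exists_superlevel_inter_ball_pos {d : ℕ} {g : Vd d → ℝ} (hg0 : ∀ v, 0 ≤ g v)
    (hmass : 0 < ∫ v : Vd d, g v) :
    ∃ R c : ℝ, 0 < R ∧ 0 < c ∧ volume ({v | c ≤ g v} ∩ Metric.ball 0 R) ≠ 0 := by
  by_contra! hcon
  refine hmass.ne' (integral_eq_zero_of_ae ?_)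
  have h : volume (⋃ n : ℕ, {v | ((n : ℝ) + 1)⁻¹ ≤ g v} ∩ Metric.ball 0 ((n : ℝ) + 1)) = 0 :=
    measure_iUnion_null fun n => hcon _ _ (by positivity) (by positivity)
  refine measure_mono_null (fun v hv => ?_) h
  have hv' : 0 < g v := lt_of_le_of_ne (hg0 v) (Ne.symm hv)
  obtain ⟨n, hn⟩ := exists_nat_gt (max (g v)⁻¹ ‖v‖)
  obtain ⟨hn1, hn2⟩ := max_lt_iff.1 hn
  refine Set.mem_iUnion.2 ⟨n, ?_, ?_⟩
  · exact inv_le_of_inv_le₀ hv' (by linarith)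
  · rw [mem_ball_zero_iff]
    linarith

/-- Lower bound for the twice-iterated gain operator (Lemma 3.8, after
Pulvirenti-Wennberg). -/
theorem iterated_qplus_lower_bound
    (d : ℕ) (hd : 2 ≤ d) (γ : ℝ) (hγ₁ : -(d : ℝ) < γ) (hγ₂ : γ ≤ 1)
    (cΦ : ℝ) (hcΦ : 0 < cΦ)
    (Φ : ℝ → ℝ) (hΦ0 : ∀ z : ℝ, 0 ≤ Φ z) (hΦ : ∀ z : ℝ, 0 < z → cΦ * z ^ γ ≤ Φ z)
    (b : ℝ → ℝ) (hbm : Measurable b) (hb0 : ∀ s : ℝ, 0 ≤ b s) (hlb : 0 < lbConst b)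
    (g : Vd d → ℝ) (hgm : Measurable g) (hg0 : ∀ v : Vd d, 0 ≤ g v)
    (hgint : Integrable g) (hmass : 0 < ∫ v : Vd d, g v)
    (henergy : Integrable fun v : Vd d => ‖v‖ ^ 2 * g v)
    (hentropy : Integrable fun v : Vd d => g v * |Real.log (g v)|) :
    ∃ R₀ : ℝ, 0 < R₀ ∧ ∃ r₀ : ℝ, 0 < r₀ ∧ ∃ η₀ : ℝ, 0 < η₀ ∧
      ∃ vbar ∈ Metric.ball (0 : Vd d) R₀,
        ∀ v ∈ Metric.ball vbar r₀,
          ENNReal.ofReal η₀ ≤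
            QplusE d Φ b
              (QplusE d Φ b
                ((Metric.ball (0 : Vd d) R₀).indicator fun w => ENNReal.ofReal (g w))
                ((Metric.ball (0 : Vd d) R₀).indicator fun w => ENNReal.ofReal (g w)))
              ((Metric.ball (0 : Vd d) R₀).indicator fun w => ENNReal.ofReal (g w)) v := by
  obtain ⟨R, c, hR, hc, hA0⟩ := exists_superlevel_inter_ball_pos hg0 hmass
  set A : Set (Vd d) := {v | c ≤ g v} ∩ Metric.ball 0 R
  have hA : MeasurableSet A := (hgm measurableSet_Ici).inter measurableSet_ball
  have hA' : volume A ≠ ∞ := measure_ne_top_of_subset Set.inter_subset_right measure_ball_lt_top.ne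
  obtain ⟨v₁, r₁, hr₁, η₁, hη₁, h₁⟩ :=
    exists_ball_le_QplusE hd hcΦ hΦ hb0 hlb hA hA0 hA' hA hA0 hA' hc hc
  obtain ⟨v₂, r₂, hr₂, η₂, hη₂, h₂⟩ :=
    exists_ball_le_QplusE hd hcΦ hΦ hb0 hlb hA hA0 hA' measurableSet_ball
      (Metric.measure_ball_pos volume v₁ hr₁).ne' measure_ball_lt_top.ne hη₁ hc
  refine ⟨max R (‖v₂‖ + 1), lt_max_of_lt_left hR, r₂, hr₂, η₂, hη₂, v₂, ?_, ?_⟩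
  · rw [mem_ball_zero_iff]
    exact lt_max_of_lt_right (lt_add_one _)
  · have hF : ∀ x ∈ A, ENNReal.ofReal c ≤ (Metric.ball (0 : Vd d) (max R (‖v₂‖ + 1))).indicator
        (fun w => ENNReal.ofReal (g w)) x := fun x hx => by
      rw [Set.indicator_of_mem (Metric.ball_subset_ball (le_max_left _ _) hx.2)]
      exact ENNReal.ofReal_le_ofReal hx.1
    exact h₂ _ _ (h₁ _ _ hF hF) hF

end
end

section
/- From doubly-exponential lower bounds on dyadically growing balls to a global Maxwellian lower bound (step used in the proof of Theorem 2.2, after Mouhot). Let d ≥ 1 be an integer, c > 0 and α ∈ (0,1). Let f : ℝ^d → ℝ be a function such that for every n ∈ ℕ and every v ∈ ℝ^d with |v| ≤ c·2^{n/2} one has f(v) ≥ α^{2^n}. Then there exist ρ > 0 and θ > 0 such that f(v) ≥ ρ (2πθ)^{−d/2} exp(−|v|²/(2θ)) for all v ∈ ℝ^d. -/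
open MeasureTheory Real

noncomputable section

/-- Every `x ≥ 0` is bounded by a power of two that is at most `1 + 2 * x`. -/
lemma exists_le_two_pow_le_one_add_two_mul {x : ℝ} (hx : 0 ≤ x) :
    ∃ n : ℕ, x ≤ 2 ^ n ∧ (2 : ℝ) ^ n ≤ 1 + 2 * x := by
  rcases le_total x 1 with h | h
  · exact ⟨0, by simpa using h, by simpa using hx⟩
  · obtain ⟨n, hn, hn'⟩ := exists_nat_pow_near h (one_lt_two : (1 : ℝ) < 2)
    exact ⟨n + 1, hn'.le, by rw [pow_succ]; linarith⟩

/-- From doubly-exponential lower bounds on dyadically growing balls to a global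
Maxwellian lower bound. -/
theorem maxwellian_lower_bound_from_dyadic_bounds
    (d : ℕ) (hd : 1 ≤ d) (c : ℝ) (hc : 0 < c) (α : ℝ) (hα : α ∈ Set.Ioo (0 : ℝ) 1)
    (f : Vd d → ℝ)
    (hf : ∀ n : ℕ, ∀ v : Vd d, ‖v‖ ≤ c * 2 ^ ((n : ℝ) / 2) → α ^ 2 ^ n ≤ f v) :
    ∃ ρ : ℝ, 0 < ρ ∧ ∃ θ : ℝ, 0 < θ ∧
      ∀ v : Vd d,
        ρ * (2 * π * θ) ^ (-(d : ℝ) / 2) * Real.exp (-‖v‖ ^ 2 / (2 * θ)) ≤ f v := by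
  obtain ⟨hα0, hα1⟩ := hα
  have hL : 0 < -Real.log α := neg_pos.2 (Real.log_neg hα0 hα1)
  set L := -Real.log α with hLdef
  have hαL : α = Real.exp (-L) := by rw [hLdef, neg_neg, Real.exp_log hα0]
  have hθ : 0 < c ^ 2 / (4 * L) := by positivity
  have hnorm : 0 < (2 * π * (c ^ 2 / (4 * L))) ^ (-(d : ℝ) / 2) := by positivity
  refine ⟨α / (2 * π * (c ^ 2 / (4 * L))) ^ (-(d : ℝ) / 2), by positivity,
    c ^ 2 / (4 * L), hθ, fun v => ?_⟩
  rw [div_mul_cancel₀ _ hnorm.ne']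
  obtain ⟨n, hn, hn'⟩ :=
    exists_le_two_pow_le_one_add_two_mul (x := ‖v‖ ^ 2 / c ^ 2) (by positivity)
  have hv : ‖v‖ ≤ c * 2 ^ ((n : ℝ) / 2) := by
    refine (sq_le_sq₀ (norm_nonneg v) (by positivity)).1 ?_
    have hsq : ((2 : ℝ) ^ ((n : ℝ) / 2)) ^ 2 = 2 ^ n := by
      rw [← Real.rpow_natCast, ← Real.rpow_mul zero_le_two, ← Real.rpow_natCast]
      congr 1
      push_cast
      ring
    rw [mul_pow, hsq, mul_comm]
    exact (div_le_iff₀ (by positivity)).1 hn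
  refine le_trans ?_ (hf n v hv)
  have hexp : -‖v‖ ^ 2 / (2 * (c ^ 2 / (4 * L))) = -(L * (2 * (‖v‖ ^ 2 / c ^ 2))) := by
    field_simp
    ring
  rw [hexp, hαL, ← Real.exp_add, ← Real.exp_nat_mul, Real.exp_le_exp]
  push_cast
  nlinarith [mul_le_mul_of_nonneg_left hn' hL.le]

end
end

section
/- Doubly-exponential lower bound for a recursively defined sequence (step 1 of the proof of Theorem 2.2). Let λ > 0 and α₁ ∈ (0,1]. Let (a_n)_{n≥0} and (b_n)_{n≥0} be sequences of strictly positive real numbers such that: b_n ≥ α₁^{2^n} for all n ≥ 0; a₀ ≥ b₀ and a₁ ≥ b₁; and a_{n+1} ≥ λ^n · ( min(a_n, b_n) )² for all n ≥ 1. Then there exists α₂ ∈ (0,1] such that a_n ≥ α₂^{2^n} for all n ≥ 0 (one may take α₂ = min(1,λ)·α₁). -/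
noncomputable section

/-- If `x n` is bounded below by `α ^ 2 ^ n` at `n = 0, 1` and satisfies
`μ ^ n * min (x n) (α ^ 2 ^ n) ^ 2 ≤ x (n + 1)` from then on, then it is bounded below by
`(μ * α) ^ 2 ^ n`, with a factor `μ ^ (n + 1)` to spare. -/
theorem mul_pow_two_pow_le_of_min_sq_le {μ α : ℝ} (hμ : 0 < μ) (hμ' : μ ≤ 1) (hα : 0 < α)
    {x : ℕ → ℝ} (h0 : α ≤ x 0) (h1 : α ^ 2 ≤ x 1)
    (hrec : ∀ n : ℕ, 1 ≤ n → μ ^ n * min (x n) (α ^ 2 ^ n) ^ 2 ≤ x (n + 1)) (n : ℕ) :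
    (μ * α) ^ 2 ^ n ≤ μ ^ (n + 1) * x n := by
  induction n with
  | zero => simpa using mul_le_mul_of_nonneg_left h0 hμ.le
  | succ n ih =>
    rcases Nat.eq_zero_or_pos n with rfl | hn
    · simpa [mul_pow] using mul_le_mul_of_nonneg_left h1 (pow_pos hμ 2).le
    · have hb : (μ * α) ^ 2 ^ n ≤ μ ^ (n + 1) * α ^ 2 ^ n := by
        rw [mul_pow]
        exact mul_le_mul_of_nonneg_right
          (pow_le_pow_of_le_one hμ.le hμ' Nat.lt_two_pow_self) (by positivity)
      have hmin : (μ * α) ^ 2 ^ n ≤ μ ^ (n + 1) * min (x n) (α ^ 2 ^ n) := by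
        rw [mul_min_of_nonneg _ _ (by positivity)]
        exact le_min ih hb
      calc (μ * α) ^ 2 ^ (n + 1) = ((μ * α) ^ 2 ^ n) ^ 2 := by rw [pow_succ 2 n, pow_mul]
        _ ≤ (μ ^ (n + 1) * min (x n) (α ^ 2 ^ n)) ^ 2 := by gcongr
        _ = μ ^ (n + 1 + 1) * (μ ^ n * min (x n) (α ^ 2 ^ n) ^ 2) := by ring
        _ ≤ μ ^ (n + 1 + 1) * x (n + 1) := by gcongr; exact hrec n hn

/-- Doubly-exponential lower bound for a recursively defined sequence (step 1 of the
proof of Theorem 2.2). -/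
theorem doubly_exponential_lower_bound_sequence
    (lam : ℝ) (hlam : 0 < lam) (α₁ : ℝ) (hα₁ : 0 < α₁) (hα₁' : α₁ ≤ 1)
    (a b : ℕ → ℝ) (ha : ∀ n, 0 < a n) (hb : ∀ n, 0 < b n)
    (hbn : ∀ n : ℕ, α₁ ^ 2 ^ n ≤ b n)
    (h0 : b 0 ≤ a 0) (h1 : b 1 ≤ a 1)
    (hrec : ∀ n : ℕ, 1 ≤ n → lam ^ n * min (a n) (b n) ^ 2 ≤ a (n + 1)) :
    ∃ α₂ : ℝ, 0 < α₂ ∧ α₂ ≤ 1 ∧ ∀ n : ℕ, α₂ ^ 2 ^ n ≤ a n := by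
  have hμ : 0 < min 1 lam := lt_min one_pos hlam
  have hμ' : min 1 lam ≤ 1 := min_le_left _ _
  refine ⟨min 1 lam * α₁, by positivity, mul_le_one₀ hμ' hα₁.le hα₁', fun n => ?_⟩
  refine (mul_pow_two_pow_le_of_min_sq_le hμ hμ' hα₁ (x := a) ?_ ?_ (fun k hk => ?_) n).trans
    (mul_le_of_le_one_left (ha n).le (pow_le_one₀ hμ.le hμ'))
  · simpa using (hbn 0).trans h0
  · simpa using (hbn 1).trans h1
  · have hmin : 0 ≤ min (a k) (α₁ ^ 2 ^ k) := le_min (ha k).le (by positivity)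
    refine le_trans ?_ (hrec k hk)
    gcongr
    · exact min_le_right _ _
    · exact hbn k

end
end
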